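/- Let Δ be a fundamental discriminant and r ∈ ℤ with Δ ≡ r² (mod 4N). For h ∈ K'/K, κ ∈ K'/ΔK, a ∈ ℤ/Δℤ, and s ∈ ℤ/Δℤ, the exponential sum g_h(κ,a,s) = Σ_{κ' ∈ K'/ΔK, κ' ≡ rh (mod L), b' (mod Δ), Q(κ'+sℓ'+b'ℓ) ≡ ΔQ(h) (mod Δ)} χ_Δ(κ'+sℓ'+b'ℓ) e(−((κ,κ')+ab')/|Δ|) equals ε|Δ|^{1/2} Σ_{h' ∈ K'/K, κ ≡ rh' (mod K)} e(−sgn(Δ)(h,h')) Σ_{b (mod Δ), Q(κ+aℓ'+bℓ) ≡ ΔQ(h') (mod Δ)} χ_Δ(κ+aℓ'+bℓ) e(bs/|Δ|), where ε = 1 if Δ > 0 and ε = i if Δ < 0. -/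

import Mathlib

noncomputable section

open Complex
open scoped Classical Manifold

/-- `e(x) = exp(2πix)`. -/
def e (x : ℂ) : ℂ := Complex.exp (2 * (Real.pi : ℂ) * Complex.I * x)

/-- `D` is a fundamental discriminant: either `D ≡ 1 (mod 4)` and squarefree, or
`D = 4m` with `m ≡ 2, 3 (mod 4)` squarefree. -/
def IsFundamentalDiscriminant (D : ℤ) : Prop :=
  (D % 4 = 1 ∧ Squarefree D) ∨
    (D % 4 = 0 ∧ Squarefree (D / 4) ∧ (D / 4 % 4 = 2 ∨ D / 4 % 4 = 3))

/-- The Kronecker symbol `(a/2)`. -/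
def kron2 (a : ℤ) : ℤ :=
  if a % 2 = 0 then 0 else if a % 8 = 1 ∨ a % 8 = 7 then 1 else -1

/-- The Kronecker symbol `(a/n)`, extending the Jacobi symbol to arbitrary integers `n`. -/
def kronecker (a n : ℤ) : ℤ :=
  if n = 0 then (if a = 1 ∨ a = -1 then 1 else 0)
  else
    (if n < 0 ∧ a < 0 then -1 else 1) * kron2 a ^ n.natAbs.factorization 2 *
      jacobiSym a (n.natAbs / 2 ^ n.natAbs.factorization 2)

/-- The discriminant `b² - 4Nac` of the integral binary quadratic form `[a, b, Nc]`
corresponding to the lattice vector `λ = [[b/2N, -a/N], [c, -b/2N]] ∈ L'`;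
note `Q(λ) = (b² - 4Nac)/(4N)`. -/
def QD (N : ℕ) (a b c : ℤ) : ℤ := b ^ 2 - 4 * (N : ℤ) * a * c

/-- The condition under which the generalized genus character `χ_Δ` is non-zero at `[a, b, Nc]`:
`Δ ∣ b² - 4Nac`, `(b² - 4Nac)/Δ` is a square modulo `4N`, and `gcd(a, b, c, Δ) = 1`. -/
def GenusCharCond (N : ℕ) (Δ a b c : ℤ) : Prop :=
  Δ ∣ QD N a b c ∧ (∃ s : ℤ, QD N a b c / Δ ≡ s ^ 2 [ZMOD (4 * (N : ℤ))]) ∧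
    Int.gcd (Int.gcd (Int.gcd a b) c) Δ = 1

/-- `χ` (with `χ a b c` meaning `χ_Δ` applied to the vector of `L'` corresponding to the
binary quadratic form `[a, b, Nc]`) is the generalized genus character `χ_Δ` of
Gross–Kohnen–Zagier: it only depends on the argument modulo `ΔL`, it vanishes unless
`GenusCharCond` holds, and in that case it equals the Kronecker symbol `(Δ/n)` for any
integer `n` prime to `Δ` represented by one of the forms `[N₁a, b, N₂c]` with
`N₁N₂ = N`, `N₁, N₂ > 0`. -/
def IsGenusChar (N : ℕ) (Δ : ℤ) (χ : ℤ → ℤ → ℤ → ℤ) : Prop :=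
  (∀ a b c a' b' c' : ℤ,
      a ≡ a' [ZMOD Δ] → b ≡ b' [ZMOD (2 * (N : ℤ) * Δ)] → c ≡ c' [ZMOD Δ] →
      χ a b c = χ a' b' c') ∧
  (∀ a b c : ℤ, ¬ GenusCharCond N Δ a b c → χ a b c = 0) ∧
  (∀ a b c n : ℤ, GenusCharCond N Δ a b c → Int.gcd n Δ = 1 →
      (∃ N₁ N₂ x y : ℤ, N₁ * N₂ = (N : ℤ) ∧ 0 < N₁ ∧ 0 < N₂ ∧
        n = N₁ * a * x ^ 2 + b * x * y + N₂ * c * y ^ 2) →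
      χ a b c = kronecker Δ n)

lemma IsFundamentalDiscriminant.ne_zero {D : ℤ} (hD : IsFundamentalDiscriminant D) : D ≠ 0 := by
  rintro rfl
  rcases hD with ⟨h, -⟩ | ⟨-, -, h | h⟩ <;> simp at h

lemma kronecker_natCast (a : ℤ) {n : ℕ} (hn : n ≠ 0) :
    kronecker a n = kron2 a ^ n.factorization 2 * jacobiSym a (n / 2 ^ n.factorization 2) := by
  have h0 : ¬ ((n : ℤ) < 0 ∧ a < 0) := by omega
  simp [kronecker, hn]

lemma kronecker_natCast_of_odd (a : ℤ) {n : ℕ} (hn : Odd n) : kronecker a n = jacobiSym a n := by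
  have h2 : ¬ 2 ∣ n := fun h => (Nat.not_even_iff_odd.mpr hn) (even_iff_two_dvd.mpr h)
  rw [kronecker_natCast a hn.pos.ne', Nat.factorization_eq_zero_of_not_dvd h2]
  simp

lemma kronecker_one (a : ℤ) : kronecker a (1 : ℕ) = 1 := by
  rw [kronecker_natCast_of_odd a odd_one, jacobiSym.one_right]

lemma kronecker_mul (a : ℤ) {m n : ℕ} (hm : m ≠ 0) (hn : n ≠ 0) :
    kronecker a (m * n : ℕ) = kronecker a m * kronecker a n := by
  rw [kronecker_natCast a hm, kronecker_natCast a hn, kronecker_natCast a (mul_ne_zero hm hn),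
    Nat.factorization_mul hm hn, Finsupp.add_apply, pow_add]
  have h1 := Nat.ordCompl_mul m n 2
  rw [Nat.factorization_mul hm hn, Finsupp.add_apply] at h1
  rw [h1, jacobiSym.mul_right' a (Nat.ordCompl_pos 2 hm).ne' (Nat.ordCompl_pos 2 hn).ne']
  ring

lemma odd_ordCompl_two {n : ℕ} (hn : n ≠ 0) : Odd (n / 2 ^ n.factorization 2) := by
  rw [← Nat.not_even_iff_odd, even_iff_two_dvd]
  exact Nat.not_dvd_ordCompl Nat.prime_two hn

lemma jacobiSym_two_of_mod_four_eq_one {D : ℤ} (h : D % 4 = 1) :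
    jacobiSym 2 D.natAbs = kron2 D := by
  have hodd : Odd D.natAbs := by rw [Int.natAbs_odd, Int.odd_iff]; omega
  rw [jacobiSym.at_two hodd, ZMod.χ₈_nat_eq_if_mod_eight, kron2]
  split_ifs <;> omega

lemma jacobiSym_swap_of_mod_four_eq_one {D : ℤ} (h : D % 4 = 1) {n : ℕ} (hn : Odd n) :
    jacobiSym D n = jacobiSym n D.natAbs := by
  rcases le_or_gt 0 D with h0 | h0
  · obtain ⟨d, rfl⟩ := Int.eq_ofNat_of_zero_le h0
    rw [Int.natAbs_natCast]
    exact jacobiSym.quadratic_reciprocity_one_mod_four (by omega) hn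
  · obtain ⟨d, hd⟩ : ∃ d : ℕ, D = -(d : ℤ) := ⟨D.natAbs, by omega⟩
    subst hd
    rw [Int.natAbs_neg, Int.natAbs_natCast, jacobiSym.neg _ hn]
    have hd3 : d % 4 = 3 := by omega
    have hn2 := Nat.odd_iff.mp hn
    rcases (by omega : n % 4 = 1 ∨ n % 4 = 3) with h1 | h1
    · rw [ZMod.χ₄_nat_one_mod_four h1, one_mul]
      exact (jacobiSym.quadratic_reciprocity_one_mod_four h1 (Nat.odd_iff.mpr (by omega))).symm
    · rw [ZMod.χ₄_nat_three_mod_four h1, jacobiSym.quadratic_reciprocity_three_mod_four hd3 h1]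
      ring

lemma kronecker_eq_jacobiSym_of_mod_four_eq_one {D : ℤ} (h : D % 4 = 1) {n : ℕ} (hn : n ≠ 0) :
    kronecker D n = jacobiSym n D.natAbs := by
  rw [kronecker_natCast D hn, jacobiSym_swap_of_mod_four_eq_one h (odd_ordCompl_two hn),
    ← jacobiSym_two_of_mod_four_eq_one h, ← jacobiSym.pow_left, ← jacobiSym.mul_left]
  congr 1
  exact_mod_cast Nat.ordProj_mul_ordCompl_eq_self n 2

lemma odd_of_coprime_of_mod_four_eq_zero {D : ℤ} (h : D % 4 = 0) {n : ℕ}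
    (hn : n.Coprime D.natAbs) : Odd n := by
  rw [← Nat.not_even_iff_odd, even_iff_two_dvd]
  intro h2
  have : 2 ∣ D.natAbs := by omega
  have := Nat.dvd_gcd h2 this
  rw [hn] at this
  omega

lemma kronecker_eq_jacobiSym_of_mod_four_eq_zero {D : ℤ} (h : D % 4 = 0) {n : ℕ}
    (hn : Odd n) : kronecker D n = jacobiSym (D / 4) n := by
  rw [kronecker_natCast_of_odd D hn, jacobiSym.div_four_left h (Nat.odd_iff.mp hn)]

lemma kronecker_periodic {D : ℤ} (hD : IsFundamentalDiscriminant D) {m n : ℕ} (hm : m ≠ 0)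
    (hn : n ≠ 0) (hmD : m.Coprime D.natAbs) (hnD : n.Coprime D.natAbs)
    (h : m ≡ n [MOD D.natAbs]) : kronecker D m = kronecker D n := by
  rcases hD with ⟨h1, -⟩ | ⟨h0, -, -⟩
  · rw [kronecker_eq_jacobiSym_of_mod_four_eq_one h1 hm,
      kronecker_eq_jacobiSym_of_mod_four_eq_one h1 hn]
    exact jacobiSym.mod_left' (by exact_mod_cast h)
  · have hmo := odd_of_coprime_of_mod_four_eq_zero h0 hmD
    have hno := odd_of_coprime_of_mod_four_eq_zero h0 hnD
    rw [kronecker_eq_jacobiSym_of_mod_four_eq_zero h0 hmo,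
      kronecker_eq_jacobiSym_of_mod_four_eq_zero h0 hno,
      jacobiSym.mod_right _ hmo, jacobiSym.mod_right _ hno]
    have : 4 * (D / 4).natAbs = D.natAbs := by omega
    rw [this, h]

lemma kronecker_eq_one_or_neg_one {D : ℤ} {n : ℕ} (hn : n ≠ 0)
    (h : n.Coprime D.natAbs) : kronecker D n = 1 ∨ kronecker D n = -1 := by
  rw [kronecker_natCast D hn]
  have h1 : jacobiSym D (n / 2 ^ n.factorization 2) = 1 ∨
      jacobiSym D (n / 2 ^ n.factorization 2) = -1 := by
    apply jacobiSym.eq_one_or_neg_one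
    rw [Int.gcd, Int.natAbs_natCast, Nat.gcd_comm]
    exact Nat.Coprime.coprime_dvd_left (Nat.ordCompl_dvd n 2) h
  have h2 : kron2 D ^ n.factorization 2 = 1 ∨ kron2 D ^ n.factorization 2 = -1 := by
    by_cases hk : n.factorization 2 = 0
    · simp [hk]
    · have h2n : 2 ∣ n := Nat.dvd_of_factorization_pos hk
      have hD2 : ¬ D % 2 = 0 := by
        intro hD
        have := Nat.dvd_gcd h2n (by omega : 2 ∣ D.natAbs)
        rw [h] at this
        omega
      have h3 : kron2 D = 1 ∨ kron2 D = -1 := by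
        rw [kron2, if_neg hD2]; split_ifs <;> simp
      rcases h3 with h3 | h3
      · simp [h3]
      · rw [h3]; exact neg_one_pow_eq_or ℤ _
  rcases h1 with h1 | h1 <;> rcases h2 with h2 | h2 <;> simp [h1, h2]

lemma kronecker_eq_one_of_sq {D : ℤ} {n : ℕ} (hn : n ≠ 0) (h : n.Coprime D.natAbs)
    {w c : ℤ} (hw : D = w ^ 2 - 4 * n * c) : kronecker D n = 1 := by
  rw [kronecker_natCast D hn]
  have h1 : jacobiSym D (n / 2 ^ n.factorization 2) = 1 := by
    have hdvd : ((n / 2 ^ n.factorization 2 : ℕ) : ℤ) ∣ n := by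
      exact_mod_cast Nat.ordCompl_dvd n 2
    set n' := n / 2 ^ n.factorization 2 with hn'
    have hmod : D % n' = w ^ 2 % n' := by
      apply Int.ModEq.symm
      rw [Int.modEq_iff_dvd]
      obtain ⟨k, hk⟩ := hdvd
      exact ⟨-(4 * k * c), by rw [hw, hk]; ring⟩
    rw [jacobiSym.mod_left' hmod]
    apply jacobiSym.sq_one'
    have hc : IsCoprime (n' : ℤ) D := by
      rw [Int.isCoprime_iff_gcd_eq_one, Int.gcd, Int.natAbs_natCast]
      exact Nat.Coprime.coprime_dvd_left (Nat.ordCompl_dvd n 2) h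
    rw [← Int.isCoprime_iff_gcd_eq_one]
    obtain ⟨k, hk⟩ := hdvd
    have h3 : IsCoprime (n' : ℤ) (w ^ 2) := by
      have : w ^ 2 = D + n' * (4 * k * c) := by rw [hw, hk]; ring
      rw [this]
      exact hc.add_mul_left_right _
    exact (IsCoprime.pow_right_iff (by norm_num)).mp h3 |>.symm
  have h2 : kron2 D ^ n.factorization 2 = 1 := by
    by_cases hk : n.factorization 2 = 0
    · simp [hk]
    · have h2n : 2 ∣ n := Nat.dvd_of_factorization_pos hk
      have hD2 : ¬ D % 2 = 0 := by
        intro hD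
        have := Nat.dvd_gcd h2n (by omega : 2 ∣ D.natAbs)
        rw [h] at this
        omega
      obtain ⟨k, rfl⟩ := h2n
      have hw2 : Odd w := by
        rw [← Int.not_even_iff_odd]
        rintro ⟨x, rfl⟩
        apply hD2
        rw [hw]
        push_cast
        ring_nf
        omega
      have h8' : w ^ 2 % 8 = 1 := by
        obtain ⟨k, rfl⟩ := hw2
        obtain ⟨j, hj⟩ := (Int.even_mul_succ_self k)
        have : (2 * k + 1) ^ 2 = 8 * j + 1 := by linear_combination 4 * hj
        omega
      have hD8 : D % 8 = 1 := by
        rw [hw]; push_cast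
        have : w ^ 2 - 4 * (2 * (k:ℤ)) * c = w ^ 2 - 8 * (k * c) := by ring
        rw [this]; omega
      rw [kron2, if_neg hD2, if_pos (Or.inl hD8), one_pow]
  rw [h1, h2, one_mul]

lemma kronecker_form_value {D A B C : ℤ} (hABC : B ^ 2 - 4 * A * C = D)
    {t h : ℤ} {n : ℕ} (hn : n ≠ 0) (hv : A * t ^ 2 + B * t * h + C * h ^ 2 = n)
    (hc : n.Coprime D.natAbs) : kronecker D n = 1 := by
  by_cases hg : Int.gcd t h = 0
  · rw [Int.gcd_eq_zero_iff] at hg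
    simp only [hg.1, hg.2] at hv
    simp at hv
    omega
  obtain ⟨t', ht⟩ := Int.gcd_dvd_left t h
  obtain ⟨h', hh⟩ := Int.gcd_dvd_right t h
  have hcop := Int.gcd_div_gcd_div_gcd (Nat.pos_of_ne_zero hg)
  set g := Int.gcd t h with hgdef
  have hg0 : (g : ℤ) ≠ 0 := by exact_mod_cast hg
  have ht' : t / g = t' := by conv_lhs => rw [ht, Int.mul_ediv_cancel_left _ hg0]
  have hh' : h / g = h' := by conv_lhs => rw [hh, Int.mul_ediv_cancel_left _ hg0]
  rw [ht', hh', ← Int.isCoprime_iff_gcd_eq_one] at hcop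
  obtain ⟨x, y, hxy⟩ := hcop
  have hfac : (n : ℤ) = g ^ 2 * (A * t' ^ 2 + B * t' * h' + C * h' ^ 2) := by
    rw [← hv, ht, hh]; ring
  have hpos : 0 < A * t' ^ 2 + B * t' * h' + C * h' ^ 2 := by
    have h1 : (0 : ℤ) < n := by exact_mod_cast Nat.pos_of_ne_zero hn
    rw [hfac] at h1
    exact pos_of_mul_pos_right h1 (by positivity)
  obtain ⟨f, hf⟩ := Int.eq_ofNat_of_zero_le hpos.le
  rw [hf] at hfac
  have hnf : n = g * (g * f) := by
    have : (n : ℤ) = (g * (g * f) : ℕ) := by rw [hfac]; push_cast; ring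
    exact_mod_cast this
  have hf0 : f ≠ 0 := by rintro rfl; simp at hf; omega
  have hgc : g.Coprime D.natAbs := Nat.Coprime.coprime_dvd_left ⟨_, hnf⟩ hc
  have hfc : f.Coprime D.natAbs := Nat.Coprime.coprime_dvd_left ⟨g * g, by rw [hnf]; ring⟩ hc
  have hkf : kronecker D f = 1 := by
    apply kronecker_eq_one_of_sq hf0 hfc
      (w := 2 * A * t' * (-y) + B * (t' * x + h' * (-y)) + 2 * C * h' * x)
      (c := A * y ^ 2 - B * y * x + C * x ^ 2)
    have h1 : (f : ℤ) = A * t' ^ 2 + B * t' * h' + C * h' ^ 2 := by rw [hf]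
    rw [h1, ← hABC]
    linear_combination (-(B ^ 2 - 4 * A * C)) * (x * t' + y * h' + 1) * hxy
  rw [hnf, kronecker_mul D hg (mul_ne_zero hg hf0), kronecker_mul D hg hf0, hkf]
  rcases kronecker_eq_one_or_neg_one hg hgc with h1 | h1 <;> simp [h1]

lemma exists_jacobiSym_eq_neg_one {p d : ℕ} (hp : p.Prime) (hp2 : p ≠ 2) (hpd : d.Coprime p) :
    ∃ n : ℕ, n ≡ 1 [MOD d] ∧ n ≠ 0 ∧ n.Coprime (d * p) ∧ jacobiSym n p = -1 := by
  have := Fact.mk hp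
  obtain ⟨x, hx⟩ := FiniteField.exists_nonsquare (F := ZMod p) (by rwa [ZMod.ringChar_zmod_n])
  obtain ⟨n, hn1, hn2⟩ := Nat.chineseRemainder hpd 1 x.val
  have hnx : ((n : ℤ) : ZMod p) = x := by
    rw [Int.cast_natCast, (ZMod.natCast_eq_natCast_iff n x.val p).mpr hn2, ZMod.natCast_zmod_val]
  have hxu : x ≠ 0 := by rintro rfl; exact hx (IsSquare.zero)
  have hnp : n.Coprime p := by
    rw [← ZMod.isUnit_iff_coprime, ← Int.cast_natCast, hnx]
    exact isUnit_iff_ne_zero.mpr hxu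
  have hnd : n.Coprime d := by
    rw [Nat.Coprime, hn1.gcd_eq, Nat.gcd_one_left]
  have hn0 : n ≠ 0 := by
    rintro rfl
    exact hp.one_lt.ne' (by simpa using hnp)
  refine ⟨n, hn1, hn0, hnd.mul_right hnp, ?_⟩
  rw [← jacobiSym.legendreSym.to_jacobiSym, legendreSym.eq_neg_one_iff, hnx]
  exact hx

lemma jacobiSym_eq_one_of_modEq_one {a : ℤ} {n : ℕ} (h : n ≡ 1 [MOD (4 * a.natAbs)]) :
    jacobiSym a n = 1 := by
  have hodd : Odd n := by
    have h4 : n ≡ 1 [MOD 4] := h.of_mul_right _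
    rw [Nat.odd_iff]; unfold Nat.ModEq at h4; omega
  rw [jacobiSym.mod_right a hodd, h, ← jacobiSym.mod_right a odd_one, jacobiSym.one_right]

lemma exists_kronecker_eq_neg_one {D : ℤ} (hD : IsFundamentalDiscriminant D) {p d : ℕ}
    (hp : p.Prime) (hpd : D.natAbs = d * p) :
    ∃ n : ℕ, n ≠ 0 ∧ n.Coprime D.natAbs ∧ n ≡ 1 [MOD d] ∧ kronecker D n = -1 := by
  have hD0 := hD.ne_zero
  have hd0 : d ≠ 0 := by rintro rfl; simp at hpd; exact hD0 hpd
  rcases hD with ⟨h1, hsq⟩ | ⟨h0, hsq, hm⟩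
  · have hp2 : p ≠ 2 := by rintro rfl; omega
    have hsq' : Squarefree (d * p) := by rw [← hpd]; exact Int.squarefree_natAbs.mpr hsq
    obtain ⟨n, hn1, hn0, hnc, hn⟩ := exists_jacobiSym_eq_neg_one hp hp2
      (Nat.coprime_of_squarefree_mul hsq')
    refine ⟨n, hn0, hpd ▸ hnc, hn1, ?_⟩
    rw [kronecker_eq_jacobiSym_of_mod_four_eq_one h1 hn0, hpd,
      jacobiSym.mul_right' _ hd0 hp.ne_zero, hn]
    have : jacobiSym (n : ℤ) d = jacobiSym 1 d := jacobiSym.mod_left' (by exact_mod_cast hn1)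
    rw [this, jacobiSym.one_left]; norm_num
  · obtain ⟨m, rfl⟩ : ∃ m, D = 4 * m := ⟨D / 4, by omega⟩
    have hm4 : 4 * m / 4 = m := by omega
    rw [hm4] at hsq hm
    have hm0 : m ≠ 0 := by omega
    by_cases hp2 : p = 2
    · subst hp2
      have hd : d = 2 * m.natAbs := by omega
      rcases hm with hm | hm
      · obtain ⟨k, rfl⟩ : ∃ k, m = 2 * k := ⟨m / 2, by omega⟩
        have hk : k % 2 = 1 := by omega
        have hcop : (1 + 4 * k.natAbs).Coprime (4 * (2 * k)).natAbs := by
          have : (4 * (2 * k)).natAbs = 2 * (4 * k.natAbs) := by omega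
          rw [this]
          apply Nat.Coprime.mul_right
          · rw [Nat.coprime_two_right, Nat.odd_iff]; omega
          · simp
        refine ⟨1 + 4 * k.natAbs, by omega, hcop, ?_, ?_⟩
        · have : d = 4 * k.natAbs := by omega
          rw [this]; simp [Nat.ModEq]
        · have hodd : Odd (1 + 4 * k.natAbs) := by rw [Nat.odd_iff]; omega
          rw [kronecker_eq_jacobiSym_of_mod_four_eq_zero h0 hodd, hm4, jacobiSym.mul_left,
            jacobiSym_eq_one_of_modEq_one (a := k) (by simp [Nat.ModEq]),
            jacobiSym.at_two hodd, ZMod.χ₈_nat_eq_if_mod_eight]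
          have h8 : (1 + 4 * k.natAbs) % 8 = 5 := by omega
          have h2 : (1 + 4 * k.natAbs) % 2 = 1 := by omega
          simp [h8, h2]
      · have hcop : (1 + 2 * m.natAbs).Coprime (4 * m).natAbs := by
          have : (4 * m).natAbs = 2 * (2 * m.natAbs) := by omega
          rw [this]
          apply Nat.Coprime.mul_right
          · rw [Nat.coprime_two_right, Nat.odd_iff]; omega
          · simp
        refine ⟨1 + 2 * m.natAbs, by omega, hcop, ?_, ?_⟩
        · rw [hd]; simp [Nat.ModEq]
        · have hodd : Odd (1 + 2 * m.natAbs) := by rw [Nat.odd_iff]; omega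
          have h1 : (-m) % 4 = 1 := by omega
          have hmm : m = (-1) * (-m) := by ring
          rw [kronecker_eq_jacobiSym_of_mod_four_eq_zero h0 hodd, hm4]
          rw [show jacobiSym m _ = jacobiSym ((-1) * (-m)) _ from
            congrArg (fun x => jacobiSym x (1 + 2 * m.natAbs)) hmm, jacobiSym.mul_left, jacobiSym.at_neg_one hodd,
            jacobiSym_swap_of_mod_four_eq_one h1 hodd, ZMod.χ₄_nat_three_mod_four (by omega)]
          have : jacobiSym ((1 + 2 * m.natAbs : ℕ) : ℤ) (-m).natAbs = jacobiSym 1 (-m).natAbs := by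
            apply jacobiSym.mod_left'
            rw [Int.natAbs_neg]
            push_cast
            rw [Int.add_mul_emod_self_right]
          rw [this, jacobiSym.one_left]; norm_num
    · have hpm : p ∣ m.natAbs := by
        have h4 : p ∣ 4 * m.natAbs := ⟨d, by rw [mul_comm p, ← hpd]; omega⟩
        rcases hp.dvd_mul.mp h4 with h | h
        · exfalso
          have : p ∣ 2 ^ 2 := h
          exact hp2 ((Nat.prime_dvd_prime_iff_eq hp Nat.prime_two).mp (hp.dvd_of_dvd_pow this))
        · exact h
      have hpodd := hp.odd_of_ne_two hp2
      obtain ⟨ps, hps, hps1⟩ : ∃ q : ℤ, q.natAbs = p ∧ q % 4 = 1 := by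
        rcases Nat.odd_mod_four_iff.mp (Nat.odd_iff.mp hpodd) with h | h
        · exact ⟨p, by simp, by omega⟩
        · exact ⟨-p, by simp, by omega⟩
      obtain ⟨m', hm'⟩ : ps ∣ m := by rw [← Int.natAbs_dvd_natAbs, hps]; exact hpm
      have hm'0 : m' ≠ 0 := by rintro rfl; simp at hm'; exact hm0 hm'
      have hmabs : m.natAbs = p * m'.natAbs := by rw [hm', Int.natAbs_mul, hps]
      have hd : d = 4 * m'.natAbs := by
        have h3 : d * p = 4 * m'.natAbs * p := by rw [← hpd, Int.natAbs_mul, hmabs]; ring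
        exact Nat.eq_of_mul_eq_mul_right hp.pos h3
      have hcop : d.Coprime p := by
        rw [hd]
        have hsq' : Squarefree (p * m'.natAbs) := by rw [← hmabs]; exact Int.squarefree_natAbs.mpr hsq
        refine Nat.Coprime.mul_left ?_ (Nat.coprime_of_squarefree_mul hsq').symm
        have : Nat.Coprime (2 ^ 2) p := Nat.Coprime.pow_left 2 (Nat.coprime_two_left.mpr hpodd)
        exact this
      obtain ⟨n, hn1, hn0, hnc, hn⟩ := exists_jacobiSym_eq_neg_one hp hp2 hcop
      rw [← hpd] at hnc
      refine ⟨n, hn0, hnc, hn1, ?_⟩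
      have hodd := odd_of_coprime_of_mod_four_eq_zero h0 hnc
      rw [kronecker_eq_jacobiSym_of_mod_four_eq_zero h0 hodd, hm4, hm', jacobiSym.mul_left,
        jacobiSym_swap_of_mod_four_eq_one hps1 hodd, hps, hn,
        jacobiSym_eq_one_of_modEq_one (hd ▸ hn1)]
      norm_num

lemma IsFundamentalDiscriminant.natAbs_pos {D : ℤ} (hD : IsFundamentalDiscriminant D) :
    0 < D.natAbs := Int.natAbs_pos.mpr hD.ne_zero

/-- The quadratic character modulo `|D|` attached to a fundamental discriminant `D`. -/
def fundChar {D : ℤ} (hD : IsFundamentalDiscriminant D) : DirichletCharacter ℂ D.natAbs where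
  toFun c := if IsUnit c then (kronecker D ((c.val + D.natAbs : ℕ) : ℤ) : ℂ) else 0
  map_one' := by
    have : NeZero D.natAbs := ⟨hD.natAbs_pos.ne'⟩
    have h := kronecker_periodic hD (m := (1 : ZMod D.natAbs).val + D.natAbs) (n := 1)
      (by have := hD.natAbs_pos; omega) one_ne_zero
      (by rw [← ZMod.isUnit_iff_coprime]; simp) (Nat.coprime_one_left _)
      (by rw [← ZMod.natCast_eq_natCast_iff]; simp)
    rw [if_pos isUnit_one, h, kronecker_one]; norm_num
  map_mul' x y := by
    have : NeZero D.natAbs := ⟨hD.natAbs_pos.ne'⟩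
    have hpos := hD.natAbs_pos
    by_cases hx : IsUnit x
    · by_cases hy : IsUnit y
      · have h := kronecker_periodic hD (m := (x * y).val + D.natAbs)
          (n := (x.val + D.natAbs) * (y.val + D.natAbs)) (by omega)
          (mul_ne_zero (by omega) (by omega))
          (by rw [← ZMod.isUnit_iff_coprime]; simpa using ⟨hx, hy⟩)
          (by rw [← ZMod.isUnit_iff_coprime]; simpa using ⟨hx, hy⟩)
          (by rw [← ZMod.natCast_eq_natCast_iff]; simp)
        rw [if_pos (hx.mul hy), if_pos hx, if_pos hy, h,
          kronecker_mul D (by omega) (by omega), Int.cast_mul]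
      · have : ¬ IsUnit (x * y) := fun h => hy (isUnit_of_mul_isUnit_right h)
        rw [if_neg this, if_neg hy, mul_zero]
    · have : ¬ IsUnit (x * y) := fun h => hx (isUnit_of_mul_isUnit_left h)
      rw [if_neg this, if_neg hx, zero_mul]
  map_nonunit' c hc := if_neg hc

lemma fundChar_apply_natCast {D : ℤ} (hD : IsFundamentalDiscriminant D) {n : ℕ} (hn : n ≠ 0)
    (hc : n.Coprime D.natAbs) : fundChar hD (n : ZMod D.natAbs) = kronecker D n := by
  have : NeZero D.natAbs := ⟨hD.natAbs_pos.ne'⟩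
  have hu : IsUnit (n : ZMod D.natAbs) := (ZMod.isUnit_iff_coprime _ _).mpr hc
  have h := kronecker_periodic hD (m := (n : ZMod D.natAbs).val + D.natAbs) (n := n)
      (by have := hD.natAbs_pos; omega) hn
      (by rw [← ZMod.isUnit_iff_coprime]; simpa using hu) hc
      (by rw [← ZMod.natCast_eq_natCast_iff]; simp)
  rw [← h]
  exact if_pos hu

lemma fundChar_eq_one_or_neg_one {D : ℤ} (hD : IsFundamentalDiscriminant D) {x : ZMod D.natAbs}
    (hx : IsUnit x) : fundChar hD x = 1 ∨ fundChar hD x = -1 := by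
  have : NeZero D.natAbs := ⟨hD.natAbs_pos.ne'⟩
  have hpos := hD.natAbs_pos
  have hxe : x = ((x.val + D.natAbs : ℕ) : ZMod D.natAbs) := by simp
  rw [hxe] at hx ⊢
  have hc := (ZMod.isUnit_iff_coprime _ _).mp hx
  rw [fundChar_apply_natCast hD (by omega) hc]
  rcases kronecker_eq_one_or_neg_one (D := D) (by omega) hc with h | h <;> rw [h] <;> simp

lemma fundChar_mul_self {D : ℤ} (hD : IsFundamentalDiscriminant D) {x : ZMod D.natAbs}
    (hx : IsUnit x) : fundChar hD x * fundChar hD x = 1 := by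
  rcases fundChar_eq_one_or_neg_one hD hx with h | h <;> rw [h] <;> norm_num

lemma fundChar_isQuadratic {D : ℤ} (hD : IsFundamentalDiscriminant D) :
    (fundChar hD).IsQuadratic := fun x => by
  by_cases hx : IsUnit x
  · exact Or.inr (fundChar_eq_one_or_neg_one hD hx)
  · exact Or.inl (MulChar.map_nonunit _ hx)

lemma fundChar_isPrimitive {D : ℤ} (hD : IsFundamentalDiscriminant D) :
    (fundChar hD).IsPrimitive := by
  have : NeZero D.natAbs := ⟨hD.natAbs_pos.ne'⟩
  by_contra hne
  obtain ⟨k, hk⟩ := (fundChar hD).conductor_dvd_level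
  have hk1 : k ≠ 1 := by
    rintro rfl
    exact hne (by rw [mul_one] at hk; exact hk.symm)
  obtain ⟨p, hp, l, rfl⟩ := Nat.exists_prime_and_dvd hk1
  obtain ⟨n, hn0, hnc, hn1, hkn⟩ := exists_kronecker_eq_neg_one hD hp
    (d := (fundChar hD).conductor * l) (hk.trans (by ring))
  obtain ⟨hdvd, χ', hχ'⟩ := (fundChar hD).factorsThrough_conductor
  have h1 := fundChar_apply_natCast hD hn0 hnc
  have hu : IsUnit (n : ZMod D.natAbs) := (ZMod.isUnit_iff_coprime _ _).mpr hnc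
  have h2 : fundChar hD (n : ZMod D.natAbs) = 1 := by
    rw [hχ', ← hu.unit_spec, DirichletCharacter.changeLevel_eq_cast_of_dvd, hu.unit_spec,
      ZMod.cast_natCast hdvd]
    have : (n : ZMod (fundChar hD).conductor) = 1 := by
      have := (ZMod.natCast_eq_natCast_iff n 1 _).mpr (hn1.of_mul_right l)
      simpa using this
    rw [this, map_one]
  rw [h1, hkn] at h2
  norm_num at h2

lemma fundChar_form {D A B C : ℤ} (hD : IsFundamentalDiscriminant D) (hABC : B ^ 2 - 4 * A * C = D)
    (hA : 0 < A) {t h : ZMod D.natAbs} (hu : IsUnit ((A : ZMod D.natAbs) * t ^ 2 + B * t * h +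
      C * h ^ 2)) : fundChar hD (A * t ^ 2 + B * t * h + C * h ^ 2) = 1 := by
  have : NeZero D.natAbs := ⟨hD.natAbs_pos.ne'⟩
  have hpos := hD.natAbs_pos
  set H : ℤ := (h.val : ℤ) with hH
  set k : ℤ := |B * H| + |C| * H ^ 2 + 1 with hk
  set T : ℤ := t.val + D.natAbs * k with hT
  have hTk : k ≤ T := by
    have h1 : (1 : ℤ) ≤ D.natAbs := by exact_mod_cast hpos
    have h2 : 0 ≤ k := by positivity
    nlinarith [Nat.zero_le t.val]
  have hval : 0 < A * T ^ 2 + B * T * H + C * H ^ 2 := by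
    have h1 : 0 ≤ |B * H| := abs_nonneg _
    have h2 : 0 ≤ |C| * H ^ 2 := by positivity
    have h3 : T ≤ A * T := by nlinarith
    have h4 : |C| * H ^ 2 + 1 ≤ A * T + B * H := by linarith [neg_abs_le (B * H)]
    have h5 : A * T + B * H ≤ T * (A * T + B * H) := by nlinarith
    have h6 : -(|C| * H ^ 2) ≤ C * H ^ 2 := by nlinarith [neg_abs_le C, sq_nonneg H]
    nlinarith
  obtain ⟨n, hn⟩ := Int.eq_ofNat_of_zero_le hval.le
  have hn0 : n ≠ 0 := by rintro rfl; rw [hn] at hval; simp at hval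
  have hcast : (A : ZMod D.natAbs) * t ^ 2 + B * t * h + C * h ^ 2 = (n : ℕ) := by
    have h1 : ((T : ℤ) : ZMod D.natAbs) = t := by
      rw [hT, Int.cast_add, Int.cast_mul, Int.cast_natCast, Int.cast_natCast]
      simp
    have h2 : ((H : ℤ) : ZMod D.natAbs) = h := by rw [hH]; simp
    rw [← Int.cast_natCast n]; rw [show ((n : ℕ) : ℤ) = _ from hn.symm]
    push_cast
    rw [h1, h2]
  rw [hcast] at hu ⊢
  have hc := (ZMod.isUnit_iff_coprime _ _).mp hu
  rw [fundChar_apply_natCast hD hn0 hc, kronecker_form_value hABC hn0 hn hc]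
  norm_num

/-- The Gauss sum of `fundChar`. -/
def fundGauss {D : ℤ} (hD : IsFundamentalDiscriminant D) : ℂ :=
  haveI : NeZero D.natAbs := ⟨hD.natAbs_pos.ne'⟩
  gaussSum (fundChar hD) ZMod.stdAddChar

lemma sum_fundChar_mul {D : ℤ} [NeZero D.natAbs] (hD : IsFundamentalDiscriminant D)
    (k : ZMod D.natAbs) :
    ∑ c, fundChar hD c * ZMod.stdAddChar (c * k) = fundChar hD k * fundGauss hD := by
  have h := gaussSum_mulShift_of_isPrimitive (ZMod.stdAddChar (N := D.natAbs))
    (fundChar_isPrimitive hD) k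
  rw [(fundChar_isQuadratic hD).inv] at h
  rw [fundGauss, ← h, gaussSum]
  refine Finset.sum_congr rfl fun c _ => ?_
  rw [AddChar.mulShift_apply, mul_comm k c]

lemma fundGauss_sq {D : ℤ} (hD : IsFundamentalDiscriminant D) :
    fundGauss hD ^ 2 = fundChar hD (-1) * D.natAbs := by
  have : NeZero D.natAbs := ⟨hD.natAbs_pos.ne'⟩
  have h1 : ∀ k : ZMod D.natAbs, ZMod.dft (fundChar hD) k = fundChar hD (-k) * fundGauss hD := by
    intro k
    rw [ZMod.dft_apply, ← sum_fundChar_mul]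
    refine Finset.sum_congr rfl fun c _ => ?_
    rw [smul_eq_mul, mul_comm, mul_neg]
  have h2 := congrFun (ZMod.dft_dft (fundChar hD)) 1
  rw [ZMod.dft_apply] at h2
  simp only [h1, smul_eq_mul, mul_one] at h2
  rw [mul_comm, ← h2, ← Equiv.sum_comp (Equiv.neg (ZMod D.natAbs))]
  simp only [Equiv.neg_apply, neg_neg]
  have h3 := sum_fundChar_mul hD 1
  simp only [mul_one, map_one, one_mul] at h3
  rw [sq]
  nth_rewrite 1 [← h3]
  rw [Finset.sum_mul]
  refine Finset.sum_congr rfl fun c _ => ?_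
  ring

lemma norm_fundGauss_sq {D : ℤ} (hD : IsFundamentalDiscriminant D) :
    ‖fundGauss hD‖ ^ 2 = D.natAbs := by
  rw [← norm_pow, fundGauss_sq, norm_mul]
  rcases fundChar_eq_one_or_neg_one hD (isUnit_one.neg) with h | h <;> rw [h] <;> simp

lemma summable_cexp_neg_mul_int_sq {a : ℂ} (ha : 0 < a.re) :
    Summable fun n : ℤ => Complex.exp (-Real.pi * a * n ^ 2) := by
  have h := (summable_jacobiTheta₂_term_iff 0 (I * a)).mpr (by simpa using ha)
  refine h.congr fun n => ?_
  rw [jacobiTheta₂_term]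
  congr 1
  linear_combination (Real.pi * n ^ 2 * a : ℂ) * I_sq

lemma tsum_int_residues (M : ℕ) [NeZero M] {f : ℤ → ℂ} (hf : Summable f) :
    ∑' n, f n = ∑ t ∈ Finset.range M, ∑' k : ℤ, f (k * M + t) := by
  have h := (Int.divModEquiv M).symm.tsum_eq f
  rw [← h, ← (Equiv.prodComm (Fin M) ℤ).tsum_eq]
  have hs : Summable fun p : Fin M × ℤ =>
      f ((Int.divModEquiv M).symm ((Equiv.prodComm (Fin M) ℤ) p)) :=
    (((Equiv.prodComm (Fin M) ℤ).trans (Int.divModEquiv M).symm).summable_iff).mpr hf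
  rw [hs.tsum_prod' fun b => hs.comp_injective (Prod.mk_right_injective b), tsum_fintype,
    Finset.sum_range]
  rfl

/-- The Gaussian sum over the shifted lattice `ℤ + x`. -/
def shiftedTheta (x : ℝ) (A : ℂ) : ℂ := ∑' k : ℤ, Complex.exp (-Real.pi / A * (k + x) ^ 2)

lemma shiftedTheta_eq {A : ℂ} (hA : 0 < A.re) (x : ℝ) :
    shiftedTheta x A = A ^ (1 / 2 : ℂ) *
      ∑' n : ℤ, Complex.exp (-Real.pi * A * n ^ 2 - 2 * Real.pi * I * x * n) := by
  have h := Complex.tsum_exp_neg_quadratic hA (-I * x)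
  have hA0 : A ≠ 0 := by rintro rfl; simp at hA
  have h2 : A ^ (1 / 2 : ℂ) ≠ 0 := by rw [Ne, Complex.cpow_eq_zero_iff]; tauto
  have e1 : ∀ n : ℤ, Complex.exp (-Real.pi / A * (n + I * (-I * x)) ^ 2) =
      Complex.exp (-Real.pi / A * (n + x) ^ 2) := fun n => by
    congr 3
    linear_combination (-x : ℂ) * I_sq
  have e2 : ∀ n : ℤ, Complex.exp (-Real.pi * A * n ^ 2 + 2 * Real.pi * (-I * x) * n) =
      Complex.exp (-Real.pi * A * n ^ 2 - 2 * Real.pi * I * x * n) := fun n => by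
    congr 1; ring
  simp only [e1, e2] at h
  rw [h, shiftedTheta]
  field_simp

lemma cpow_ofReal_mul {T : ℝ} (hT : 0 < T) {z : ℂ} (hz : z ≠ 0) (s : ℂ) :
    ((T : ℂ) * z) ^ s = (T : ℂ) ^ s * z ^ s := by
  have hT' : (T : ℂ) ≠ 0 := by exact_mod_cast hT.ne'
  rw [Complex.cpow_def_of_ne_zero (mul_ne_zero hT' hz), Complex.cpow_def_of_ne_zero hT',
    Complex.cpow_def_of_ne_zero hz, Complex.log_ofReal_mul hT hz, add_mul, Complex.exp_add,
    Complex.ofReal_log hT.le]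

open Filter Topology in
lemma tendsto_shiftedTheta (x c : ℝ) :
    Tendsto (fun T : ℝ => shiftedTheta x (T + c * I) / (Real.sqrt T : ℂ)) atTop (𝓝 1) := by
  have hS : Tendsto (fun T : ℝ => ∑' n : ℤ, Complex.exp (-Real.pi * (T + c * I) * n ^ 2 -
      2 * Real.pi * I * x * n)) atTop (𝓝 (∑' n : ℤ, if n = 0 then 1 else 0)) := by
    have hnorm : ∀ (T : ℝ) (n : ℤ), ‖Complex.exp (-Real.pi * (T + c * I) * n ^ 2 -
        2 * Real.pi * I * x * n)‖ = Real.exp (-Real.pi * n ^ 2 * T) := fun T n => by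
      rw [Complex.norm_exp]
      congr 1
      have : (-Real.pi * (T + c * I) * n ^ 2 - 2 * Real.pi * I * x * n : ℂ) =
        ((-Real.pi * n ^ 2 * T : ℝ) : ℂ) + ((-Real.pi * c * n ^ 2 - 2 * Real.pi * x * n : ℝ) : ℂ) * I := by
        push_cast; ring
      rw [this, Complex.add_re, Complex.ofReal_re, Complex.re_ofReal_mul, I_re, mul_zero, add_zero]
    refine tendsto_tsum_of_dominated_convergence
      (bound := fun n : ℤ => Real.exp (-Real.pi * n ^ 2 * 1)) ?_ ?_ ?_
    · have := (summable_cexp_neg_mul_int_sq (a := 1) (by simp)).norm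
      refine this.congr fun n => ?_
      rw [Complex.norm_exp]
      congr 1
      have : (-Real.pi * 1 * n ^ 2 : ℂ) = ((-Real.pi * n ^ 2 * 1 : ℝ) : ℂ) := by push_cast; ring
      rw [this, Complex.ofReal_re]
    · intro n
      by_cases hn : n = 0
      · simp [hn]
      · rw [if_neg hn, tendsto_zero_iff_norm_tendsto_zero]
        simp only [hnorm]
        refine Real.tendsto_exp_atBot.comp ?_
        refine Tendsto.const_mul_atTop_of_neg ?_ tendsto_id
        have : (0 : ℝ) < n ^ 2 := by positivity
        nlinarith [Real.pi_pos]
    · filter_upwards [eventually_ge_atTop 1] with T hT n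
      rw [hnorm]
      apply Real.exp_le_exp.mpr
      have : 0 ≤ Real.pi * (n : ℝ) ^ 2 := by positivity
      nlinarith
  rw [tsum_ite_eq] at hS
  have hR : Tendsto (fun T : ℝ => ((1 : ℂ) + ((c / T : ℝ) : ℂ) * I) ^ (1 / 2 : ℂ)) atTop (𝓝 1) := by
    have h0 : Tendsto (fun T : ℝ => (1 : ℂ) + ((c / T : ℝ) : ℂ) * I) atTop (𝓝 1) := by
      have h1 : Tendsto (fun T : ℝ => c / T) atTop (𝓝 0) := tendsto_const_nhds.div_atTop tendsto_id
      have h2 := (Complex.continuous_ofReal.tendsto 0).comp h1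
      simpa using (h2.mul_const I).const_add (1 : ℂ)
    have := (continuousAt_cpow_const (a := 1) (b := (1 / 2 : ℂ)) (by simp)).tendsto.comp h0
    rw [Complex.one_cpow] at this
    exact this
  have hP := hR.mul hS
  rw [one_mul] at hP
  refine hP.congr' ?_
  filter_upwards [eventually_gt_atTop 0] with T hT
  have hTs : (Real.sqrt T : ℂ) ≠ 0 := by
    rw [Complex.ofReal_ne_zero]; exact (Real.sqrt_pos.mpr hT).ne'
  rw [shiftedTheta_eq (by simpa using hT)]
  have h1 : (T + c * I : ℂ) = (T : ℂ) * (1 + ((c / T : ℝ) : ℂ) * I) := by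
    have : (T : ℂ) ≠ 0 := by exact_mod_cast hT.ne'
    push_cast
    field_simp
  have h2 : (T + c * I : ℂ) ^ (1 / 2 : ℂ) = (Real.sqrt T : ℂ) *
      (1 + ((c / T : ℝ) : ℂ) * I) ^ (1 / 2 : ℂ) := by
    have h3 : (1 + ((c / T : ℝ) : ℂ) * I) ≠ 0 := fun h => by
      have := congrArg Complex.re h
      simp at this
    rw [h1, cpow_ofReal_mul hT h3, Real.sqrt_eq_rpow, Complex.ofReal_cpow hT.le]
    norm_num
  rw [h2]
  field_simp

lemma theta_reciprocity (D : ℕ) [NeZero D] {T : ℝ} (hT : 0 < T) :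
    ∑ t ∈ Finset.range D, Complex.exp (2 * Real.pi * I * (t ^ 2 / D)) * shiftedTheta (t / D) T =
      1 / (1 / (T * D ^ 2) - 2 * I / D : ℂ) ^ (1 / 2 : ℂ) *
      ∑ t ∈ Finset.range 2, Complex.exp (-Real.pi * I * D * t ^ 2 / 2) *
        shiftedTheta (t / 2) (T + (1 / (2 * D) : ℝ) * I) := by
  have hD0 : (D : ℂ) ≠ 0 := NeZero.ne _
  have hDr : (0 : ℝ) < D := by exact_mod_cast Nat.pos_of_ne_zero (NeZero.ne D)
  have hT0 : (T : ℂ) ≠ 0 := by exact_mod_cast hT.ne'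
  set a : ℂ := 1 / (T * D ^ 2) - 2 * I / D with ha
  have hare : 0 < a.re := by
    have : a = ((1 / (T * D ^ 2) : ℝ) : ℂ) + ((-2 / D : ℝ) : ℂ) * I := by
      rw [ha]; push_cast; ring
    rw [this, Complex.add_re, Complex.ofReal_re, Complex.re_ofReal_mul, I_re, mul_zero, add_zero]
    positivity
  have hA0 : (T + (1 / (2 * D) : ℝ) * I : ℂ) ≠ 0 := fun h => by
    have := congrArg Complex.re h
    simp at this
    exact hT.ne' this
  have ha0 : a ≠ 0 := by intro h; rw [h] at hare; simp at hare
  have hinv : 1 / a = I * D / 2 + 1 / (4 * (T + (1 / (2 * D) : ℝ) * I)) := by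
    have h4 : (4 * (T + (1 / (2 * D) : ℝ) * I) : ℂ) ≠ 0 := mul_ne_zero (by norm_num) hA0
    rw [div_eq_iff ha0, add_mul, div_mul_eq_mul_div, div_mul_eq_mul_div, div_add_div _ _ two_ne_zero h4,
      eq_div_iff (mul_ne_zero two_ne_zero h4), ha]
    push_cast
    field_simp
    ring_nf
    simp only [I_sq, I_pow_three]
    ring
  have hinvre : 0 < (1 / a).re := by
    rw [one_div, Complex.inv_re]
    exact div_pos hare (Complex.normSq_pos.mpr ha0)
  have key := Complex.tsum_exp_neg_mul_int_sq hare
  have hs2 : Summable fun n : ℤ => Complex.exp (-Real.pi / a * n ^ 2) :=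
    (summable_cexp_neg_mul_int_sq hinvre).congr fun n => by congr 1; ring
  rw [tsum_int_residues D (summable_cexp_neg_mul_int_sq hare), tsum_int_residues 2 hs2] at key
  have e1 : ∀ t : ℕ, ∑' k : ℤ, Complex.exp (-Real.pi * a * ((k * D + t : ℤ) : ℂ) ^ 2) =
      Complex.exp (2 * Real.pi * I * (t ^ 2 / D)) * shiftedTheta (t / D) T := by
    intro t
    rw [shiftedTheta, ← tsum_mul_left]
    refine tsum_congr fun k => ?_
    rw [← Complex.exp_add, Complex.exp_eq_exp_iff_exists_int]
    refine ⟨k ^ 2 * D + 2 * k * t, ?_⟩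
    rw [ha]; push_cast; field_simp; ring
  have e2 : ∀ t : ℕ, ∑' k : ℤ, Complex.exp (-Real.pi / a * ((k * (2 : ℕ) + t : ℤ) : ℂ) ^ 2) =
      Complex.exp (-Real.pi * I * D * t ^ 2 / 2) *
        shiftedTheta (t / 2) (T + (1 / (2 * D) : ℝ) * I) := by
    intro t
    rw [shiftedTheta, ← tsum_mul_left]
    refine tsum_congr fun k => ?_
    rw [← Complex.exp_add, Complex.exp_eq_exp_iff_exists_int]
    refine ⟨-(k ^ 2 * D + k * t * D), ?_⟩
    rw [← mul_one_div (-Real.pi : ℂ) a, hinv]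
    generalize (T + (1 / (2 * D) : ℝ) * I : ℂ) = A at hA0 ⊢
    push_cast
    field_simp
    ring
  simp only [e1, e2] at key
  exact key

open Filter Topology in
lemma quadratic_gauss_sum_aux (D : ℕ) [NeZero D] :
    ∑ t ∈ Finset.range D, Complex.exp (2 * Real.pi * I * (t ^ 2 / D)) =
      1 / (- 2 * I / D : ℂ) ^ (1 / 2 : ℂ) *
      ∑ t ∈ Finset.range 2, Complex.exp (-Real.pi * I * D * t ^ 2 / 2) := by
  have hDr : (0 : ℝ) < D := by exact_mod_cast Nat.pos_of_ne_zero (NeZero.ne D)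
  have h1 : Tendsto (fun T : ℝ => ∑ t ∈ Finset.range D,
      Complex.exp (2 * Real.pi * I * (t ^ 2 / D)) * (shiftedTheta (t / D) (T + (0 : ℝ) * I) /
        (Real.sqrt T : ℂ))) atTop
      (𝓝 (∑ t ∈ Finset.range D, Complex.exp (2 * Real.pi * I * (t ^ 2 / D)) * 1)) :=
    tendsto_finsetSum _ fun t _ => (tendsto_shiftedTheta (t / D) 0).const_mul _
  have h2 : Tendsto (fun T : ℝ => ∑ t ∈ Finset.range 2,
      Complex.exp (-Real.pi * I * D * t ^ 2 / 2) *
        (shiftedTheta (t / 2) (T + (1 / (2 * D) : ℝ) * I) / (Real.sqrt T : ℂ))) atTop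
      (𝓝 (∑ t ∈ Finset.range 2, Complex.exp (-Real.pi * I * D * t ^ 2 / 2) * 1)) :=
    tendsto_finsetSum _ fun t _ => (tendsto_shiftedTheta (t / 2) (1 / (2 * D))).const_mul _
  have h3 : Tendsto (fun T : ℝ => 1 / (1 / (T * D ^ 2) - 2 * I / D : ℂ) ^ (1 / 2 : ℂ)) atTop
      (𝓝 (1 / (- 2 * I / D : ℂ) ^ (1 / 2 : ℂ))) := by
    have hb : (- 2 * I / D : ℂ) = ((-2 / D : ℝ) : ℂ) * I := by push_cast; ring
    have him : (- 2 * I / D : ℂ).im ≠ 0 := by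
      rw [hb, Complex.im_ofReal_mul, I_im, mul_one]
      have : (2 : ℝ) / D > 0 := by positivity
      rw [neg_div]; linarith
    have h0 : Tendsto (fun T : ℝ => (1 / (T * D ^ 2) - 2 * I / D : ℂ)) atTop
        (𝓝 (- 2 * I / D : ℂ)) := by
      have h1 : Tendsto (fun T : ℝ => 1 / (T * (D : ℝ) ^ 2)) atTop (𝓝 0) :=
        tendsto_const_nhds.div_atTop (tendsto_id.atTop_mul_const (by positivity))
      have h2 := ((Complex.continuous_ofReal.tendsto 0).comp h1).sub_const (2 * I / D : ℂ)
      have e : ((0 : ℝ) : ℂ) - 2 * I / D = - 2 * I / D := by push_cast; ring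
      rw [e] at h2
      refine h2.congr fun T => ?_
      simp
    have hc : ContinuousAt (fun z : ℂ => z ^ (1 / 2 : ℂ)) (- 2 * I / D : ℂ) :=
      continuousAt_cpow_const (Or.inr him)
    refine (tendsto_const_nhds (x := (1 : ℂ))).div (hc.tendsto.comp h0) ?_
    rw [Ne, Complex.cpow_eq_zero_iff]
    rintro ⟨h, -⟩
    rw [h] at him
    simp at him
  have h4 := h3.mul h2
  simp only [mul_one] at h1 h4
  refine tendsto_nhds_unique (h1.congr' ?_) h4
  filter_upwards [eventually_gt_atTop 0] with T hT
  have := theta_reciprocity D hT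
  simp only [← mul_div_assoc] at this ⊢
  simp only [← Finset.sum_div]
  rw [Complex.ofReal_zero, zero_mul, add_zero, this, mul_div_assoc]

lemma quadratic_gauss_sum (D : ℕ) [NeZero D] :
    ∑ t ∈ Finset.range D, Complex.exp (2 * Real.pi * I * (t ^ 2 / D)) =
      (Real.sqrt D : ℂ) * ((1 + I) / 2) * (1 + (-I) ^ D) := by
  have hDr : (0 : ℝ) < D := by exact_mod_cast Nat.pos_of_ne_zero (NeZero.ne D)
  have hD0 : (D : ℂ) ≠ 0 := NeZero.ne _
  have hs : (Real.sqrt D : ℂ) ≠ 0 := by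
    rw [Complex.ofReal_ne_zero]; exact (Real.sqrt_pos.mpr hDr).ne'
  have hss : (Real.sqrt D : ℂ) ^ 2 = D := by
    rw [← Complex.ofReal_pow, Real.sq_sqrt hDr.le]; simp
  have hroot : (- 2 * I / D : ℂ) ^ (1 / 2 : ℂ) = (1 - I) / Real.sqrt D := by
    have h1 : (- 2 * I / D : ℂ) = ((1 - I) / Real.sqrt D) ^ (2 : ℕ) := by
      rw [div_pow, hss]
      congr 1
      linear_combination (-1 : ℂ) * I_sq
    rw [h1]
    have h2 : ((1 - I) / Real.sqrt D : ℂ) = ((1 / Real.sqrt D : ℝ) : ℂ) * (1 - I) := by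
      push_cast; ring
    have hre : 0 < ((1 - I) / Real.sqrt D : ℂ).re := by
      rw [h2, Complex.re_ofReal_mul]
      simpa using Nat.pos_of_ne_zero (NeZero.ne D)
    have harg := Complex.abs_arg_lt_pi_div_two_iff.mpr (Or.inl hre)
    rw [abs_lt] at harg
    have := Complex.pow_cpow_nat_inv two_ne_zero (x := ((1 - I) / Real.sqrt D : ℂ))
      (by push_cast; linarith) (by push_cast; linarith)
    rw [one_div]
    exact_mod_cast this
  rw [quadratic_gauss_sum_aux, hroot, Finset.sum_range_succ, Finset.sum_range_one]
  have h5 : Complex.exp (-Real.pi * I * D * ((1 : ℕ) : ℂ) ^ 2 / 2) = (-I) ^ D := by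
    have : (-Real.pi * I * D * ((1 : ℕ) : ℂ) ^ 2 / 2 : ℂ) = D * (-(Real.pi / 2 * I)) := by
      push_cast; ring
    rw [this, Complex.exp_nat_mul, Complex.exp_neg, Complex.exp_pi_div_two_mul_I, Complex.inv_I]
  rw [h5]
  have h6 : (1 - I : ℂ) ≠ 0 := fun h => by
    have := congrArg Complex.re h
    simp at this
  have h7 : (1 - I : ℂ) * (1 + I) = 2 := by linear_combination (-1 : ℂ) * I_sq
  have h8 : 1 / ((1 - I) / Real.sqrt D : ℂ) = Real.sqrt D * ((1 + I) / 2) := by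
    rw [one_div_div, div_eq_iff h6]
    linear_combination (-(Real.sqrt D : ℂ) / 2) * h7
  rw [h8]
  simp

/-- The binary quadratic form `[N, r, u]`. -/
def binForm {R : Type*} [CommRing R] (N r u t h : R) : R := N * t ^ 2 + r * t * h + u * h ^ 2

/-- The polar form of `[N, r, u]`. -/
def binPolar {R : Type*} [CommRing R] (N r u t h t' h' : R) : R :=
  2 * N * t * t' + r * (t * h' + t' * h) + 2 * u * h * h'

/-- The quadratic form `[N, r, u]` plus a hyperbolic plane, on vectors `(t, h, b, s)`. -/
def quadForm {R : Type*} [CommRing R] (N r u : R) (l : R × R × R × R) : R :=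
  binForm N r u l.1 l.2.1 + l.2.2.1 * l.2.2.2

/-- The polar form of `quadForm`. -/
def quadPolar {R : Type*} [CommRing R] (N r u : R) (l m : R × R × R × R) : R :=
  binPolar N r u l.1 l.2.1 m.1 m.2.1 + l.2.2.1 * m.2.2.2 + l.2.2.2 * m.2.2.1

/-- The isotropic vector with parameters `z = (c, y)`. -/
def isoVec {R : Type*} [CommRing R] (N r u : R) (z : R × R × R) : R × R × R × R :=
  (z.1 * z.2.1, z.1 * z.2.2, z.1 ^ 2, -binForm N r u z.2.1 z.2.2)

section Algebra

variable {R : Type*} [CommRing R] (N r u : R)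

lemma quadForm_isoVec (z : R × R × R) : quadForm N r u (isoVec N r u z) = 0 := by
  simp only [quadForm, isoVec, binForm]; ring

lemma quadPolar_self (l : R × R × R × R) : quadPolar N r u l l = 2 * quadForm N r u l := by
  simp only [quadForm, quadPolar, binForm, binPolar]; ring

lemma quadPolar_comm (l m : R × R × R × R) : quadPolar N r u l m = quadPolar N r u m l := by
  simp only [quadPolar, binPolar]; ring

lemma quadPolar_add_left (l l' m : R × R × R × R) :
    quadPolar N r u (l + l') m = quadPolar N r u l m + quadPolar N r u l' m := by
  simp only [quadPolar, binPolar, Prod.fst_add, Prod.snd_add]; ring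

lemma quadPolar_sub_left (l l' m : R × R × R × R) :
    quadPolar N r u (l - l') m = quadPolar N r u l m - quadPolar N r u l' m := by
  simp only [quadPolar, binPolar, Prod.fst_sub, Prod.snd_sub]; ring

lemma quadPolar_smul_left (x : R) (l m : R × R × R × R) :
    quadPolar N r u (x • l) m = x * quadPolar N r u l m := by
  simp only [quadPolar, binPolar, Prod.smul_fst, Prod.smul_snd, smul_eq_mul]; ring

lemma quadForm_smul (x : R) (l : R × R × R × R) :
    quadForm N r u (x • l) = x ^ 2 * quadForm N r u l := by
  simp only [quadForm, binForm, Prod.smul_fst, Prod.smul_snd, smul_eq_mul]; ring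

lemma quadForm_add (l m : R × R × R × R) :
    quadForm N r u (l + m) = quadForm N r u l + quadPolar N r u l m + quadForm N r u m := by
  simp only [quadForm, binForm, quadPolar, binPolar, Prod.fst_add, Prod.snd_add]; ring

lemma binForm_eq_of_isotropic {l m : R × R × R × R} (hl : quadForm N r u l = 0)
    (hm : quadForm N r u m = 0) (z w : R × R × R) :
    ∃ t h, binForm N r u t h = quadPolar N r u l (isoVec N r u z) *
      quadPolar N r u m (isoVec N r u w) * -quadPolar N r u l m := by
  obtain ⟨t, h, b, s⟩ := l
  obtain ⟨t', h', b', s'⟩ := m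
  obtain ⟨c, p, k⟩ := z
  obtain ⟨c', p', k'⟩ := w
  simp only [quadForm, quadPolar, isoVec] at *
  set n := binPolar N r u t h (c * p) (c * k) + b * -binForm N r u p k + s * c ^ 2 with hn
  set n' := binPolar N r u t' h' (c' * p') (c' * k') + b' * -binForm N r u p' k' + s' * c' ^ 2
    with hn'
  set P0 := c * s + N * t * p + u * h * k + r * p * h with hP0
  set P1 := k * t - p * h with hP1
  set P0' := c' * s' + N * t' * p' + u * h' * k' + r * p' * h' with hP0'
  set P1' := k' * t' - p' * h' with hP1'
  set Ct := c * t - b * p with hCt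
  set Ch := c * h - b * k with hCh
  set Ct' := c' * t' - b' * p' with hCt'
  set Ch' := c' * h' - b' * k' with hCh'
  have a1 : P0 ^ 2 + r * P0 * P1 + N * u * P1 ^ 2 = s * n := by
    rw [hn, hP0, hP1]; simp only [binForm, binPolar] at hl ⊢
    linear_combination (N * p ^ 2 + r * p * k + u * k ^ 2) * hl
  have a2 : P0' ^ 2 + r * P0' * P1' + N * u * P1' ^ 2 = s' * n' := by
    rw [hn', hP0', hP1']; simp only [binForm, binPolar] at hm ⊢
    linear_combination (N * p' ^ 2 + r * p' * k' + u * k' ^ 2) * hm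
  have b1 : binForm N r u Ct Ch = - b * n := by
    rw [hn, hCt, hCh]; simp only [binForm, binPolar] at hl ⊢
    linear_combination c ^ 2 * hl
  have b2 : binForm N r u Ct' Ch' = - b' * n' := by
    rw [hn', hCt', hCh']; simp only [binForm, binPolar] at hm ⊢
    linear_combination c' ^ 2 * hm
  have e1 : (P0 + r * P1) * Ct + u * P1 * Ch = n * t := by
    rw [hn, hCt, hCh, hP0, hP1]; simp only [binForm, binPolar] at hl ⊢
    linear_combination (-c * p) * hl
  have e2 : P0 * Ch - N * P1 * Ct = n * h := by
    rw [hn, hCt, hCh, hP0, hP1]; simp only [binForm, binPolar] at hl ⊢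
    linear_combination (-c * k) * hl
  have e1' : (P0' + r * P1') * Ct' + u * P1' * Ch' = n' * t' := by
    rw [hn', hCt', hCh', hP0', hP1']; simp only [binForm, binPolar] at hm ⊢
    linear_combination (-c' * p') * hm
  have e2' : P0' * Ch' - N * P1' * Ct' = n' * h' := by
    rw [hn', hCt', hCh', hP0', hP1']; simp only [binForm, binPolar] at hm ⊢
    linear_combination (-c' * k') * hm
  refine ⟨P0 * Ct' - u * P1 * Ch' - (P0' * Ct - u * P1' * Ch),
    P0 * Ch' + P1 * (N * Ct' + r * Ch') - (P0' * Ch + P1' * (N * Ct + r * Ch)), ?_⟩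
  have g : binForm N r u (P0 * Ct' - u * P1 * Ch' - (P0' * Ct - u * P1' * Ch))
      (P0 * Ch' + P1 * (N * Ct' + r * Ch') - (P0' * Ch + P1' * (N * Ct + r * Ch))) =
      (P0 ^ 2 + r * P0 * P1 + N * u * P1 ^ 2) * binForm N r u Ct' Ch' +
      (P0' ^ 2 + r * P0' * P1' + N * u * P1' ^ 2) * binForm N r u Ct Ch -
      binPolar N r u ((P0' + r * P1') * Ct' + u * P1' * Ch') (P0' * Ch' - N * P1' * Ct')
        ((P0 + r * P1) * Ct + u * P1 * Ch) (P0 * Ch - N * P1 * Ct) := by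
    simp only [binForm, binPolar]; ring
  rw [g, a1, a2, b1, b2, e1, e2, e1', e2']
  simp only [binPolar]
  ring

lemma exists_form_eq_of_isotropic {N₁ N₂ : R} {l : R × R × R × R}
    (hl : quadForm (N₁ * N₂) r u l = 0) (z : R × R × R) (X Y : R) :
    ∃ t h, binForm N₂ r (N₁ * u) t h =
      (-(N₁ * l.2.2.1) * X ^ 2 + (2 * (N₁ * N₂) * l.1 + r * l.2.1) * X * Y +
        N₂ * l.2.2.2 * Y ^ 2) * quadPolar (N₁ * N₂) r u l (isoVec (N₁ * N₂) r u z) := by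
  obtain ⟨t, h, b, s⟩ := l
  obtain ⟨c, p, k⟩ := z
  simp only [quadForm, quadPolar, isoVec, binForm, binPolar] at *
  refine ⟨Y * c * s + Y * (N₁ * N₂ * t * p + u * h * k + r * h * p) + c * X * N₁ * t -
    b * X * N₁ * p, N₂ * Y * (t * k - h * p) + c * X * h - b * X * k, ?_⟩
  linear_combination (Y ^ 2 * N₂ * (N₁ * N₂ * p ^ 2 + r * p * k + u * k ^ 2) -
    X * Y * c * (r * k + 2 * (N₁ * N₂) * p) + X ^ 2 * c ^ 2 * N₁) * hl

end Algebra

/-- A multiplicative character adapted to the form `[N, r, u]` over a finite ring. -/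
structure IsFormChar {R : Type*} [CommRing R] [Fintype R] (N r u : R) (χ : MulChar R ℂ)
    (ε : AddChar R ℂ) : Prop where
  form : ∀ t h, IsUnit (binForm N r u t h) → χ (binForm N r u t h) = 1
  mul_self : ∀ x, IsUnit x → χ x * χ x = 1
  exists_isoVec : ∀ l m, quadForm N r u l = 0 → IsUnit (quadPolar N r u l m) →
    ∃ z, IsUnit (quadPolar N r u l (isoVec N r u z))
  gauss : ∀ k, ∑ c, χ c * ε (c * k) = χ k * gaussSum χ ε
  norm_gauss : ‖gaussSum χ ε‖ ^ 2 = Fintype.card R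
  primitive : ε.IsPrimitive
  card_radical : Fintype.card {v : R × R // ∀ w : R × R, binPolar N r u v.1 v.2 w.1 w.2 = 0} ≤
    Fintype.card R

/-- The genus character on isotropic vectors. -/
def isoChar {R : Type*} [CommRing R] (N r u : R) (χ : MulChar R ℂ) (l : R × R × R × R) : ℂ :=
  if h : quadForm N r u l = 0 ∧ ∃ z, IsUnit (quadPolar N r u l (isoVec N r u z)) then
    χ (quadPolar N r u l (isoVec N r u h.2.choose)) else 0

lemma quadPolar_eq_zero_of_forall {R : Type*} [CommRing R] {N r u : R}
    {k : R × R × R × R} (h : ∀ m, quadPolar N r u k m = 0) :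
    k.2.2.1 = 0 ∧ k.2.2.2 = 0 ∧ ∀ w : R × R, binPolar N r u k.1 k.2.1 w.1 w.2 = 0 := by
  have h1 := h (0, 0, 0, 1)
  have h2 := h (0, 0, 1, 0)
  simp [quadPolar, binPolar] at h1 h2
  refine ⟨h1, h2, fun w => ?_⟩
  have h3 := h (w.1, w.2, 0, 0)
  simpa [quadPolar] using h3

lemma isoChar_eq_zero {R : Type*} [CommRing R] {N r u : R} {χ : MulChar R ℂ}
    {l : R × R × R × R}
    (h : ¬ (quadForm N r u l = 0 ∧ ∃ m, IsUnit (quadPolar N r u l m))) :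
    isoChar N r u χ l = 0 := by
  rw [isoChar, dif_neg]
  rintro ⟨h1, z, hz⟩
  exact h ⟨h1, _, hz⟩

namespace IsFormChar

variable {R : Type*} [CommRing R] [Fintype R] {N r u : R} {χ : MulChar R ℂ} {ε : AddChar R ℂ}

lemma exists_eq (H : IsFormChar N r u χ ε) {l : R × R × R × R} (hl : quadForm N r u l = 0)
    (h : ∃ m, IsUnit (quadPolar N r u l m)) :
    ∃ z, IsUnit (quadPolar N r u l (isoVec N r u z)) ∧
      isoChar N r u χ l = χ (quadPolar N r u l (isoVec N r u z)) := by
  obtain ⟨m, hm⟩ := h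
  have h' := H.exists_isoVec l m hl hm
  refine ⟨h'.choose, h'.choose_spec, ?_⟩
  rw [isoChar, dif_pos ⟨hl, h'⟩]

lemma isoChar_mul_isoChar (H : IsFormChar N r u χ ε) {l m : R × R × R × R} (hl : quadForm N r u l = 0)
    (hm : quadForm N r u m = 0) (h : IsUnit (quadPolar N r u l m)) :
    isoChar N r u χ l * isoChar N r u χ m = χ (-quadPolar N r u l m) := by
  obtain ⟨z, hz, hz'⟩ := H.exists_eq hl ⟨m, h⟩
  obtain ⟨w, hw, hw'⟩ := H.exists_eq hm ⟨l, by rwa [quadPolar_comm]⟩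
  obtain ⟨t, k, hT⟩ := binForm_eq_of_isotropic N r u hl hm z w
  have h1 := H.form t k (by rw [hT]; exact (hz.mul hw).mul h.neg)
  rw [hT, map_mul, map_mul, ← hz', ← hw'] at h1
  have h2 := H.mul_self _ h.neg
  linear_combination χ (-quadPolar N r u l m) * h1 - isoChar N r u χ l * isoChar N r u χ m * h2

lemma isoChar_mul_self (H : IsFormChar N r u χ ε) {l : R × R × R × R} (hl : quadForm N r u l = 0)
    (h : ∃ m, IsUnit (quadPolar N r u l m)) : isoChar N r u χ l * isoChar N r u χ l = 1 := by
  obtain ⟨z, hz, hz'⟩ := H.exists_eq hl h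
  rw [hz']; exact H.mul_self _ hz

lemma exists_isotropic (H : IsFormChar N r u χ ε) {l : R × R × R × R} (hl : quadForm N r u l = 0)
    (h : ∃ m, IsUnit (quadPolar N r u l m)) :
    ∃ m, quadForm N r u m = 0 ∧ IsUnit (quadPolar N r u l m) := by
  obtain ⟨z, hz, -⟩ := H.exists_eq hl h
  exact ⟨_, quadForm_isoVec N r u z, hz⟩

lemma isoChar_eq_of_pairing (H : IsFormChar N r u χ ε) {l l' m : R × R × R × R} (hl : quadForm N r u l = 0)
    (hl' : quadForm N r u l' = 0) (hm : quadForm N r u m = 0) (h : IsUnit (quadPolar N r u l m))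
    (h' : quadPolar N r u l' m = quadPolar N r u l m) :
    isoChar N r u χ l' = isoChar N r u χ l := by
  have h1 := H.isoChar_mul_isoChar hl hm h
  have h2 := H.isoChar_mul_isoChar hl' hm (by rwa [h'])
  have h3 := H.isoChar_mul_self hm ⟨l, by rwa [quadPolar_comm]⟩
  rw [h'] at h2
  linear_combination isoChar N r u χ m * (h2 - h1) + (isoChar N r u χ l - isoChar N r u χ l') * h3

lemma isoChar_smul (H : IsFormChar N r u χ ε) {c : R} (hc : IsUnit c) (l : R × R × R × R) :
    isoChar N r u χ (c • l) = χ c * isoChar N r u χ l := by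
  by_cases h : quadForm N r u l = 0 ∧ ∃ m, IsUnit (quadPolar N r u l m)
  · obtain ⟨m, hm, hlm⟩ := H.exists_isotropic h.1 h.2
    have h1 := H.isoChar_mul_isoChar h.1 hm hlm
    have h2 := H.isoChar_mul_isoChar (l := c • l) (by rw [quadForm_smul, h.1, mul_zero]) hm
      (by rw [quadPolar_smul_left]; exact hc.mul hlm)
    have h3 := H.isoChar_mul_self hm ⟨l, by rwa [quadPolar_comm]⟩
    rw [quadPolar_smul_left, ← mul_neg, map_mul] at h2
    linear_combination isoChar N r u χ m * (h2 - χ c * h1) +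
      (χ c * isoChar N r u χ l - isoChar N r u χ (c • l)) * h3
  · rw [isoChar_eq_zero h, mul_zero, isoChar_eq_zero]
    rintro ⟨h1, m, hm⟩
    rw [quadPolar_smul_left] at hm
    rw [quadForm_smul] at h1
    exact h ⟨(hc.pow 2).mul_right_eq_zero.mp h1, m, isUnit_of_mul_isUnit_right hm⟩

lemma norm_isoChar (H : IsFormChar N r u χ ε) (l : R × R × R × R) :
    ‖isoChar N r u χ l‖ = 0 ∨ ‖isoChar N r u χ l‖ = 1 := by
  by_cases h : quadForm N r u l = 0 ∧ ∃ m, IsUnit (quadPolar N r u l m)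
  · right
    have := congrArg norm (H.isoChar_mul_self h.1 h.2)
    rw [norm_mul, norm_one, ← sq] at this
    exact (pow_eq_one_iff_of_nonneg (norm_nonneg _) two_ne_zero).mp this
  · left
    rw [isoChar_eq_zero h, norm_zero]

/-- The Fourier transform of `isoChar`. -/
def isoFourier (N r u : R) (χ : MulChar R ℂ) (ε : AddChar R ℂ) (m : R × R × R × R) : ℂ :=
  ∑ l, isoChar N r u χ l * ε (-quadPolar N r u l m)

/-- The polar form as an additive map in its first argument. -/
def pairingHom {R : Type*} [CommRing R] (N r u : R) (m : R × R × R × R) : R × R × R × R →+ R :=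
  AddMonoidHom.mk' (fun l => quadPolar N r u l m) fun l l' => quadPolar_add_left N r u l l' m

lemma card_unit_pairing {m : R × R × R × R} (h : ∃ l, IsUnit (quadPolar N r u l m)) :
    Fintype.card {l : R × R × R × R // IsUnit (quadPolar N r u l m)} =
      Fintype.card {x : R // IsUnit x} * Fintype.card R ^ 3 := by
  obtain ⟨l₁, x, hx⟩ := h
  obtain ⟨l₀, hl₀⟩ : ∃ l₀, quadPolar N r u l₀ m = 1 :=
    ⟨(↑x⁻¹ : R) • l₁, by rw [quadPolar_smul_left, ← hx, Units.inv_mul]⟩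
  let E : (R × R × R × R) ≃ R × {l : R × R × R × R // quadPolar N r u l m = 0} :=
    { toFun := fun l => (quadPolar N r u l m, ⟨l - quadPolar N r u l m • l₀, by
        rw [quadPolar_sub_left, quadPolar_smul_left, hl₀, mul_one, sub_self]⟩)
      invFun := fun p => p.2.1 + p.1 • l₀
      left_inv := fun l => by simp
      right_inv := fun p => by
        have h1 : quadPolar N r u (p.2.1 + p.1 • l₀) m = p.1 := by
          rw [quadPolar_add_left, quadPolar_smul_left, hl₀, p.2.2, zero_add, mul_one]
        ext1
        · exact h1
        · apply Subtype.ext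
          change p.2.1 + p.1 • l₀ - quadPolar N r u (p.2.1 + p.1 • l₀) m • l₀ = p.2.1
          rw [h1, add_sub_cancel_right] }
  have hE : ∀ l, (E l).1 = quadPolar N r u l m := fun l => rfl
  have h1 := Fintype.card_congr E
  simp only [Fintype.card_prod] at h1
  have h2 : Fintype.card {l : R × R × R × R // IsUnit (quadPolar N r u l m)} =
      Fintype.card ({x : R // IsUnit x} × {l : R × R × R × R // quadPolar N r u l m = 0}) :=
    Fintype.card_congr ((E.subtypeEquiv fun l => by rw [hE]).trans
      (Equiv.prodSubtypeFstEquivSubtypeProd (p := fun x : R => IsUnit x)))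
  have hpos : 0 < Fintype.card R := Fintype.card_pos
  rw [h2, Fintype.card_prod]
  congr 1
  apply Nat.eq_of_mul_eq_mul_left hpos
  rw [← h1]
  ring

lemma card_isotropic_unit_pairing {m : R × R × R × R} (hm : quadForm N r u m = 0)
    (h : ∃ l, IsUnit (quadPolar N r u l m)) :
    Fintype.card {l : R × R × R × R // quadForm N r u l = 0 ∧ IsUnit (quadPolar N r u l m)} =
      Fintype.card {x : R // IsUnit x} * Fintype.card R ^ 2 := by
  have hmm : quadPolar N r u m m = 0 := by rw [quadPolar_self, hm, mul_zero]
  have hp : ∀ (l : R × R × R × R) (x : R), quadPolar N r u (l + x • m) m = quadPolar N r u l m :=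
    fun l x => by rw [quadPolar_add_left, quadPolar_smul_left, hmm, mul_zero, add_zero]
  have hq : ∀ (l : R × R × R × R) (x : R), quadForm N r u (l + x • m) =
      quadForm N r u l + x * quadPolar N r u l m := fun l x => by
    rw [quadForm_add, quadForm_smul, hm, mul_zero, add_zero, quadPolar_comm, quadPolar_smul_left,
      quadPolar_comm]
  let E : {l : R × R × R × R // quadForm N r u l = 0 ∧ IsUnit (quadPolar N r u l m)} × R ≃
      {l : R × R × R × R // IsUnit (quadPolar N r u l m)} :=
    { toFun := fun p => ⟨p.1.1 + p.2 • m, by rw [hp]; exact p.1.2.2⟩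
      invFun := fun l => (⟨l.1 + (-(quadForm N r u l.1 * ↑l.2.unit⁻¹)) • m, by
        rw [hq, hp]
        refine ⟨?_, l.2⟩
        have h1 : (↑l.2.unit⁻¹ : R) * quadPolar N r u l.1 m = 1 := l.2.val_inv_mul
        linear_combination -quadForm N r u l.1 * h1⟩, quadForm N r u l.1 * ↑l.2.unit⁻¹)
      left_inv := fun p => by
        obtain ⟨⟨l, hl, hu⟩, x⟩ := p
        have hu' : IsUnit (quadPolar N r u (l + x • m) m) := by rwa [hp]
        have h1 : (↑hu'.unit⁻¹ : R) * quadPolar N r u (l + x • m) m = 1 := hu'.val_inv_mul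
        have h2 : quadForm N r u (l + x • m) * (↑hu'.unit⁻¹ : R) = x := by
          rw [hq, hl, zero_add]
          generalize (↑hu'.unit⁻¹ : R) = y at h1 ⊢
          rw [hp] at h1
          linear_combination x * h1
        ext1
        · apply Subtype.ext
          change l + x • m + (-(quadForm N r u (l + x • m) * (↑hu'.unit⁻¹ : R))) • m = l
          rw [h2, neg_smul, add_neg_cancel_right]
        · exact h2
      right_inv := fun l => by
        apply Subtype.ext
        change l.1 + (-(quadForm N r u l.1 * ↑l.2.unit⁻¹)) • m +
          (quadForm N r u l.1 * ↑l.2.unit⁻¹) • m = l.1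
        rw [neg_smul, neg_add_cancel_right] }
  have h1 := Fintype.card_congr E
  rw [card_unit_pairing h, Fintype.card_prod] at h1
  apply Nat.eq_of_mul_eq_mul_right (Fintype.card_pos (α := R))
  rw [h1]
  ring

lemma isoFourier_of_ne_zero (H : IsFormChar N r u χ ε) {m : R × R × R × R} (hm : quadForm N r u m = 0)
    (h : ∃ l, IsUnit (quadPolar N r u m l)) :
    isoFourier N r u χ ε m = gaussSum χ ε * Fintype.card R ^ 2 * isoChar N r u χ m := by
  have hc : ∀ c : R, IsUnit c → isoFourier N r u χ ε m =
      ∑ l, χ c * isoChar N r u χ l * ε (c * -quadPolar N r u l m) := by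
    intro c hc
    let E : (R × R × R × R) ≃ (R × R × R × R) :=
      { toFun := fun l => c • l
        invFun := fun l => (↑hc.unit⁻¹ : R) • l
        left_inv := fun l => by
          change (↑hc.unit⁻¹ : R) • c • l = l
          rw [smul_smul, hc.val_inv_mul, one_smul]
        right_inv := fun l => by
          change c • (↑hc.unit⁻¹ : R) • l = l
          rw [smul_smul, hc.mul_val_inv, one_smul] }
    rw [isoFourier, ← E.sum_comp]
    refine Finset.sum_congr rfl fun l _ => ?_
    change isoChar N r u χ (c • l) * ε (-quadPolar N r u (c • l) m) = _
    rw [H.isoChar_smul hc, quadPolar_smul_left, mul_neg]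
  have h1 : (Fintype.card {x : R // IsUnit x} : ℂ) * isoFourier N r u χ ε m =
      ∑ c : R, ∑ l, χ c * isoChar N r u χ l * ε (c * -quadPolar N r u l m) := by
    rw [Fintype.card_subtype, ← nsmul_eq_mul, ← Finset.sum_const, Finset.sum_filter]
    refine Finset.sum_congr rfl fun c _ => ?_
    split_ifs with h'
    · exact hc c h'
    · simp [MulChar.map_nonunit χ h']
  have h2 : ∀ l, isoChar N r u χ l * χ (-quadPolar N r u l m) =
      if quadForm N r u l = 0 ∧ IsUnit (quadPolar N r u l m) then isoChar N r u χ m else 0 := by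
    intro l
    by_cases hl : quadForm N r u l = 0 ∧ IsUnit (quadPolar N r u l m)
    · rw [if_pos hl, ← H.isoChar_mul_isoChar hl.1 hm hl.2]
      linear_combination isoChar N r u χ m * H.isoChar_mul_self hl.1 ⟨m, hl.2⟩
    · rw [if_neg hl]
      by_cases hu : IsUnit (quadPolar N r u l m)
      · rw [isoChar_eq_zero fun h => hl ⟨h.1, hu⟩, zero_mul]
      · rw [MulChar.map_nonunit χ fun h => hu (by simpa using h.neg), mul_zero]
  have h3 : ∑ c : R, ∑ l, χ c * isoChar N r u χ l * ε (c * -quadPolar N r u l m) =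
      gaussSum χ ε * ∑ l, isoChar N r u χ l * χ (-quadPolar N r u l m) := by
    rw [Finset.sum_comm, Finset.mul_sum]
    refine Finset.sum_congr rfl fun l _ => ?_
    have := H.gauss (-quadPolar N r u l m)
    rw [← mul_assoc, mul_comm (gaussSum χ ε), mul_assoc, mul_comm (gaussSum χ ε), ← this,
      Finset.mul_sum]
    refine Finset.sum_congr rfl fun c _ => ?_
    ring
  have h' : ∃ l, IsUnit (quadPolar N r u l m) := by
    obtain ⟨l, hl⟩ := h
    exact ⟨l, by rwa [quadPolar_comm]⟩
  rw [h3, Finset.sum_congr rfl fun l _ => h2 l, ← Finset.sum_filter, Finset.sum_const,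
    ← Fintype.card_subtype, card_isotropic_unit_pairing hm h', nsmul_eq_mul] at h1
  have hpos : (Fintype.card {x : R // IsUnit x} : ℂ) ≠ 0 := by
    have : Nonempty {x : R // IsUnit x} := ⟨⟨1, isUnit_one⟩⟩
    exact_mod_cast Fintype.card_ne_zero
  apply mul_left_cancel₀ hpos
  rw [h1]
  push_cast
  ring

lemma sum_apply_quadPolar (H : IsFormChar N r u χ ε) (k : R × R × R × R) :
    ∑ m, ε (quadPolar N r u k m) =
      if ∀ m, quadPolar N r u k m = 0 then (Fintype.card R : ℂ) ^ 4 else 0 := by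
  have h1 := AddChar.sum_eq_ite (ε.compAddMonoidHom (pairingHom N r u k))
  have h2 : ∀ m, (ε.compAddMonoidHom (pairingHom N r u k)) m = ε (quadPolar N r u k m) := fun m => by
    rw [quadPolar_comm]; rfl
  simp only [h2] at h1
  rw [h1]
  split_ifs with h3 h4 h4
  · simp only [Fintype.card_prod]; push_cast; ring
  · exfalso
    push Not at h4
    obtain ⟨m, hm⟩ := h4
    obtain ⟨y, hy⟩ := (AddChar.ne_one_iff).mp (H.primitive hm)
    apply hy
    have := DFunLike.congr_fun h3 (y • m)
    rw [h2, quadPolar_comm, quadPolar_smul_left, quadPolar_comm, mul_comm] at this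
    exact this
  · exfalso
    apply h3
    ext m
    rw [h2, h4, AddChar.map_zero_eq_one]
    rfl
  · rfl

lemma sum_norm_isoFourier_sq_le (H : IsFormChar N r u χ ε) : ∑ m, ‖isoFourier N r u χ ε m‖ ^ 2 ≤
    Fintype.card R ^ 5 * ∑ l, ‖isoChar N r u χ l‖ ^ 2 := by
  have h1 : ((∑ m, ‖isoFourier N r u χ ε m‖ ^ 2 : ℝ) : ℂ) = ∑ l, ∑ l', isoChar N r u χ l *
      (starRingEnd ℂ) (isoChar N r u χ l') *
        (if ∀ m, quadPolar N r u (l' - l) m = 0 then (Fintype.card R : ℂ) ^ 4 else 0) := by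
    push_cast
    simp only [← H.sum_apply_quadPolar, Finset.mul_sum]
    have h0 : ∀ m, (‖isoFourier N r u χ ε m‖ : ℂ) ^ 2 = ∑ l, ∑ l', isoChar N r u χ l *
        (starRingEnd ℂ) (isoChar N r u χ l') * ε (quadPolar N r u (l' - l) m) := by
      intro m
      rw [← Complex.mul_conj', isoFourier, map_sum, Finset.sum_mul_sum]
      refine Finset.sum_congr rfl fun l _ => Finset.sum_congr rfl fun l' _ => ?_
      rw [map_mul, ← AddChar.map_neg_eq_conj, neg_neg, quadPolar_sub_left, sub_eq_neg_add,
        AddChar.map_add_eq_mul]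
      ring
    rw [Finset.sum_congr rfl fun m _ => h0 m, Finset.sum_comm]
    exact Finset.sum_congr rfl fun l _ => Finset.sum_comm
  have h2 : (∑ m, ‖isoFourier N r u χ ε m‖ ^ 2 : ℝ) = ‖((∑ m, ‖isoFourier N r u χ ε m‖ ^ 2 : ℝ) : ℂ)‖ := by
    rw [Complex.norm_real, Real.norm_of_nonneg (Finset.sum_nonneg fun m _ => by positivity)]
  rw [h2, h1]
  have h3 : ∀ l : R × R × R × R, ∑ l' : R × R × R × R,
      (if ∀ m, quadPolar N r u (l' - l) m = 0 then (Fintype.card R : ℝ) ^ 4 else 0) ≤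
        Fintype.card R ^ 5 := by
    intro l
    rw [← Equiv.sum_comp (Equiv.addRight l)]
    simp only [Equiv.coe_addRight, add_sub_cancel_right]
    rw [← Finset.sum_filter, Finset.sum_const, ← Fintype.card_subtype, nsmul_eq_mul]
    have h4 : Fintype.card {k : R × R × R × R // ∀ m, quadPolar N r u k m = 0} ≤ Fintype.card R := by
      refine le_trans (Fintype.card_le_of_injective (fun k => ⟨(k.1.1, k.1.2.1),
        (quadPolar_eq_zero_of_forall k.2).2.2⟩) ?_) H.card_radical
      intro k k' hk
      obtain ⟨a1, a2, -⟩ := quadPolar_eq_zero_of_forall k.2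
      obtain ⟨b1, b2, -⟩ := quadPolar_eq_zero_of_forall k'.2
      simp only [Subtype.mk.injEq, Prod.mk.injEq] at hk
      apply Subtype.ext
      ext
      · exact hk.1
      · exact hk.2
      · rw [a1, b1]
      · rw [a2, b2]
    have h5 : (Fintype.card {k : R × R × R × R // ∀ m, quadPolar N r u k m = 0} : ℝ) ≤
      Fintype.card R := by exact_mod_cast h4
    calc _ ≤ (Fintype.card R : ℝ) * Fintype.card R ^ 4 :=
          mul_le_mul_of_nonneg_right h5 (by positivity)
      _ = _ := by ring
  refine (norm_sum_le _ _).trans ?_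
  rw [Finset.mul_sum]
  refine Finset.sum_le_sum fun l _ => (norm_sum_le _ _).trans ?_
  calc _ ≤ ∑ l' : R × R × R × R, ‖isoChar N r u χ l‖ ^ 2 *
        (if ∀ m, quadPolar N r u (l' - l) m = 0 then (Fintype.card R : ℝ) ^ 4 else 0) := by
        refine Finset.sum_le_sum fun l' _ => ?_
        rw [norm_mul, norm_mul, RCLike.norm_conj]
        have h6 : ‖(if ∀ m, quadPolar N r u (l' - l) m = 0 then (Fintype.card R : ℂ) ^ 4 else 0)‖ =
            if ∀ m, quadPolar N r u (l' - l) m = 0 then (Fintype.card R : ℝ) ^ 4 else 0 := by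
          split_ifs <;> simp
        rw [h6]
        refine mul_le_mul_of_nonneg_right ?_ (by split_ifs <;> positivity)
        rcases H.norm_isoChar l with h | h <;> rcases H.norm_isoChar l' with h' | h' <;>
          rw [h, h'] <;> norm_num
    _ ≤ _ := by
        rw [← Finset.mul_sum, mul_comm]
        exact mul_le_mul_of_nonneg_right (h3 l) (by positivity)

lemma isoFourier_eq (H : IsFormChar N r u χ ε) (m : R × R × R × R) :
    isoFourier N r u χ ε m = gaussSum χ ε * Fintype.card R ^ 2 * isoChar N r u χ m := by
  by_cases hm : quadForm N r u m = 0 ∧ ∃ l, IsUnit (quadPolar N r u m l)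
  · exact H.isoFourier_of_ne_zero hm.1 hm.2
  have hle : ∀ m ∈ Finset.univ, ‖gaussSum χ ε * Fintype.card R ^ 2 * isoChar N r u χ m‖ ^ 2 ≤
      ‖isoFourier N r u χ ε m‖ ^ 2 := by
    intro m _
    by_cases hm : quadForm N r u m = 0 ∧ ∃ l, IsUnit (quadPolar N r u m l)
    · rw [H.isoFourier_of_ne_zero hm.1 hm.2]
    · rw [isoChar_eq_zero hm]
      simp
  have hsum : ∑ m, ‖gaussSum χ ε * Fintype.card R ^ 2 * isoChar N r u χ m‖ ^ 2 =
      Fintype.card R ^ 5 * ∑ l, ‖isoChar N r u χ l‖ ^ 2 := by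
    rw [Finset.mul_sum]
    refine Finset.sum_congr rfl fun l _ => ?_
    rw [norm_mul, norm_mul, mul_pow, mul_pow, H.norm_gauss, norm_pow, Complex.norm_natCast]
    ring
  have heq := le_antisymm (Finset.sum_le_sum hle) (hsum ▸ H.sum_norm_isoFourier_sq_le)
  have := (Finset.sum_eq_sum_iff_of_le hle).mp heq m (Finset.mem_univ m)
  rw [isoChar_eq_zero hm] at this ⊢
  simpa using this.symm

lemma partial_fourier (H : IsFormChar N r u χ ε) (t' h' a s : R) :
    ∑ t, ∑ h, ∑ b, isoChar N r u χ (t, h, b, s) * ε (-(binPolar N r u t h t' h' + b * a)) =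
      gaussSum χ ε * Fintype.card R * ∑ β, isoChar N r u χ (t', h', β, a) * ε (β * s) := by
  have h1 : ∀ β, isoChar N r u χ (t', h', β, a) * (gaussSum χ ε * Fintype.card R ^ 2) =
      ∑ s', (∑ t, ∑ h, ∑ b, isoChar N r u χ (t, h, b, s') *
        ε (-(binPolar N r u t h t' h' + b * a))) * ε (-(s' * β)) := by
    intro β
    rw [mul_comm, ← H.isoFourier_eq, isoFourier]
    simp only [Fintype.sum_prod_type, Finset.sum_mul]
    symm
    rw [Finset.sum_comm]
    refine Finset.sum_congr rfl fun t _ => ?_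
    rw [Finset.sum_comm]
    refine Finset.sum_congr rfl fun k _ => ?_
    rw [Finset.sum_comm]
    refine Finset.sum_congr rfl fun b _ => Finset.sum_congr rfl fun s' _ => ?_
    rw [mul_assoc, ← AddChar.map_add_eq_mul]
    congr 2
    simp only [quadPolar]
    ring
  have hR : (Fintype.card R : ℂ) ≠ 0 := by exact_mod_cast Fintype.card_ne_zero
  have h2 : (∑ β, isoChar N r u χ (t', h', β, a) * ε (β * s)) * (gaussSum χ ε * Fintype.card R ^ 2) =
      Fintype.card R * ∑ t, ∑ h, ∑ b, isoChar N r u χ (t, h, b, s) *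
        ε (-(binPolar N r u t h t' h' + b * a)) := by
    rw [Finset.sum_mul]
    have h3 : ∀ s', ∑ β, ε (β * (s - s')) = if s' = s then (Fintype.card R : ℂ) else 0 := by
      intro s'
      rw [AddChar.sum_mulShift _ H.primitive]
      simp only [sub_eq_zero, eq_comm]
      split_ifs <;> simp
    calc _ = ∑ β, ∑ s', (∑ t, ∑ h, ∑ b, isoChar N r u χ (t, h, b, s') *
        ε (-(binPolar N r u t h t' h' + b * a))) * ε (β * (s - s')) := by
          refine Finset.sum_congr rfl fun β _ => ?_
          rw [mul_right_comm, h1, Finset.sum_mul]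
          refine Finset.sum_congr rfl fun s' _ => ?_
          rw [mul_assoc, ← AddChar.map_add_eq_mul]
          congr 2
          ring
      _ = _ := by
          rw [Finset.sum_comm]
          simp only [← Finset.mul_sum, h3]
          simp [mul_comm]
  apply mul_left_cancel₀ hR
  rw [← h2]
  ring

end IsFormChar

lemma ZMod.isUnit_intCast_iff_forall_prime {n : ℕ} (x : ℤ) :
    IsUnit (x : ZMod n) ↔ ∀ p : ℕ, p.Prime → p ∣ n → ¬ (p : ℤ) ∣ x := by
  have h1 : IsUnit (x : ZMod n) ↔ IsUnit ((x.natAbs : ℕ) : ZMod n) := by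
    rcases Int.natAbs_eq x with h | h
    · conv_lhs => rw [h, Int.cast_natCast]
    · conv_lhs => rw [h, Int.cast_neg, Int.cast_natCast, IsUnit.neg_iff]
  rw [h1, ZMod.isUnit_iff_coprime]
  constructor
  · intro h p hp hpn hpx
    exact hp.not_dvd_one (h ▸ Nat.dvd_gcd (Int.natCast_dvd.mp hpx) hpn)
  · intro h
    refine Nat.coprime_of_dvd fun p hp h1 h2 => h p hp h2 (Int.natCast_dvd.mpr h1)

lemma exists_forall_prime_not_dvd_form {d : ℕ} (hd : d ≠ 0) (A B C : ℤ)
    (h : ∀ p : ℕ, p.Prime → p ∣ d → ¬ ((p : ℤ) ∣ A ∧ (p : ℤ) ∣ C)) :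
    ∃ X Y : ℤ, ∀ p : ℕ, p.Prime → p ∣ d → ¬ (p : ℤ) ∣ A * X ^ 2 + B * X * Y + C * Y ^ 2 := by
  have key : ∀ P : ℕ → Prop, ∃ X : ℤ, ∀ p : ℕ, p.Prime → p ∣ d → ((p : ℤ) ∣ X ↔ P p) := by
    intro P
    refine ⟨∏ q ∈ d.primeFactors with P q, (q : ℤ), fun p hp hpd => ?_⟩
    rw [Prime.dvd_finsetProd_iff (Nat.prime_iff_prime_int.mp hp)]
    constructor
    · rintro ⟨q, hq, hpq⟩
      rw [Finset.mem_filter, Nat.mem_primeFactors] at hq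
      have : p = q := (Nat.prime_dvd_prime_iff_eq hp hq.1.1).mp (by exact_mod_cast hpq)
      exact this ▸ hq.2
    · intro hP
      exact ⟨p, by simp [hp, hpd, hd, hP], dvd_rfl⟩
  obtain ⟨X, hX⟩ := key fun q => (q : ℤ) ∣ A
  obtain ⟨Y, hY⟩ := key fun q => ¬ (q : ℤ) ∣ A
  refine ⟨X, Y, ?_⟩
  intro p hp hpd hdvd
  have hp' := Nat.prime_iff_prime_int.mp hp
  have k1 := hX p hp hpd
  have k2 := hY p hp hpd
  by_cases hA : (p : ℤ) ∣ A
  · have hX := k1.mpr hA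
    have hY : ¬ (p : ℤ) ∣ Y := fun hy => k2.mp hy hA
    have h1 : (p : ℤ) ∣ C * Y ^ 2 := by
      have := dvd_sub hdvd (Dvd.dvd.mul_right hX (A * X + B * Y))
      ring_nf at this ⊢
      exact this
    exact (hp'.dvd_or_dvd h1).elim (fun hC => h p hp hpd ⟨hA, hC⟩)
      fun hy => hY (hp'.dvd_of_dvd_pow hy)
  · have hY := k2.mpr hA
    have hX : ¬ (p : ℤ) ∣ X := fun hx => hA (k1.mp hx)
    have h1 : (p : ℤ) ∣ A * X ^ 2 := by
      have := dvd_sub hdvd (Dvd.dvd.mul_right hY (B * X + C * Y))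
      ring_nf at this ⊢
      exact this
    exact (hp'.dvd_or_dvd h1).elim hA fun hx => hX (hp'.dvd_of_dvd_pow hx)

lemma IsFundamentalDiscriminant.not_sq_dvd {D : ℤ} (hD : IsFundamentalDiscriminant D) {p : ℕ}
    (hp : p.Prime) (hp2 : p ≠ 2) : ¬ (p : ℤ) ^ 2 ∣ D := by
  intro h
  rcases hD with ⟨-, h1⟩ | ⟨h0, h1, -⟩
  · exact (Nat.prime_iff_prime_int.mp hp).not_isUnit (h1 _ (by rwa [← sq]))
  · have h2 : D = 4 * (D / 4) := by omega
    have h3 : IsCoprime ((p : ℤ) ^ 2) 4 := by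
      have : Nat.Coprime (p ^ 2) (2 ^ 2) :=
        Nat.Coprime.pow 2 2 ((Nat.coprime_primes hp Nat.prime_two).mpr hp2)
      exact_mod_cast Nat.isCoprime_iff_coprime.mpr this
    rw [h2] at h
    exact (Nat.prime_iff_prime_int.mp hp).not_isUnit (h1 _ (by rw [← sq]; exact h3.dvd_of_dvd_mul_left h))

lemma IsFundamentalDiscriminant.not_dvd_and_dvd {D : ℤ} (hD : IsFundamentalDiscriminant D)
    {N r u : ℤ} (h : r ^ 2 - 4 * N * u = D) {p : ℕ} (hp : p.Prime) (hpD : (p : ℤ) ∣ D) :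
    ¬ ((p : ℤ) ∣ N ∧ (p : ℤ) ∣ u) := by
  rintro ⟨⟨N', rfl⟩, ⟨u', rfl⟩⟩
  have hp' := Nat.prime_iff_prime_int.mp hp
  have hr : (p : ℤ) ∣ r := by
    apply hp'.dvd_of_dvd_pow (n := 2)
    have : r ^ 2 = D + p * (4 * N' * (p * u')) := by linear_combination h
    rw [this]
    exact dvd_add hpD (dvd_mul_right _ _)
  obtain ⟨r', rfl⟩ := hr
  by_cases hp2 : p = 2
  · subst hp2
    have h4 : D = 4 * (r' ^ 2 - 4 * (N' * u')) := by rw [← h]; push_cast; ring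
    have h5 : r' ^ 2 % 4 = 0 ∨ r' ^ 2 % 4 = 1 := by
      rcases Int.even_or_odd' r' with ⟨k, rfl | rfl⟩
      · left; ring_nf; omega
      · right; ring_nf; omega
    generalize r' ^ 2 = w at *
    generalize N' * u' = v at *
    rcases hD with ⟨h6, -⟩ | ⟨-, -, h6⟩ <;> omega
  · exact hD.not_sq_dvd hp hp2 ⟨r' ^ 2 - 4 * (N' * u'), by rw [← h]; ring⟩

lemma Int.Prime.dvd_polar_of_dvd_form {D N r u : ℤ} (hD : r ^ 2 - 4 * N * u = D) {p : ℕ}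
    (hp : p.Prime) (hpD : (p : ℤ) ∣ D) {t h : ℤ}
    (hq : (p : ℤ) ∣ N * t ^ 2 + r * t * h + u * h ^ 2) :
    (p : ℤ) ∣ 2 * N * t + r * h ∧ (p : ℤ) ∣ r * t + 2 * u * h := by
  have hp' := Nat.prime_iff_prime_int.mp hp
  constructor
  · apply hp'.dvd_of_dvd_pow (n := 2)
    have : (2 * N * t + r * h) ^ 2 =
      (N * t ^ 2 + r * t * h + u * h ^ 2) * (4 * N) + D * h ^ 2 := by rw [← hD]; ring
    rw [this]
    exact dvd_add (hq.mul_right _) (hpD.mul_right _)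
  · apply hp'.dvd_of_dvd_pow (n := 2)
    have : (r * t + 2 * u * h) ^ 2 =
      (N * t ^ 2 + r * t * h + u * h ^ 2) * (4 * u) + D * t ^ 2 := by rw [← hD]; ring
    rw [this]
    exact dvd_add (hq.mul_right _) (hpD.mul_right _)

lemma IsFundamentalDiscriminant.exists_isUnit_binForm {D : ℤ} (hD : IsFundamentalDiscriminant D)
    {N r u : ℤ} (h : r ^ 2 - 4 * N * u = D) :
    ∃ y1 y2 : ℤ, IsUnit (binForm (N : ZMod D.natAbs) r u y1 y2) := by
  obtain ⟨X, Y, hXY⟩ := exists_forall_prime_not_dvd_form hD.natAbs_pos.ne' N r u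
    fun p hp hpd => hD.not_dvd_and_dvd h hp (Int.natCast_dvd.mpr hpd)
  refine ⟨X, Y, ?_⟩
  have := (ZMod.isUnit_intCast_iff_forall_prime _).mpr hXY
  push_cast at this
  exact this

lemma exists_isUnit_quadPolar_isoVec {D : ℤ} (hD : IsFundamentalDiscriminant D)
    {N r u : ℤ} (h : r ^ 2 - 4 * N * u = D)
    (l m : ZMod D.natAbs × ZMod D.natAbs × ZMod D.natAbs × ZMod D.natAbs)
    (hl : quadForm (N : ZMod D.natAbs) r u l = 0)
    (hlm : IsUnit (quadPolar (N : ZMod D.natAbs) r u l m)) :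
    ∃ z, IsUnit (quadPolar (N : ZMod D.natAbs) r u l (isoVec (N : ZMod D.natAbs) r u z)) := by
  obtain ⟨t, k, b, s⟩ := l
  obtain ⟨t', k', b', s'⟩ := m
  obtain ⟨t, rfl⟩ := ZMod.intCast_surjective t
  obtain ⟨k, rfl⟩ := ZMod.intCast_surjective k
  obtain ⟨b, rfl⟩ := ZMod.intCast_surjective b
  obtain ⟨s, rfl⟩ := ZMod.intCast_surjective s
  obtain ⟨t', rfl⟩ := ZMod.intCast_surjective t'
  obtain ⟨k', rfl⟩ := ZMod.intCast_surjective k'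
  obtain ⟨b', rfl⟩ := ZMod.intCast_surjective b'
  obtain ⟨s', rfl⟩ := ZMod.intCast_surjective s'
  obtain ⟨y1, y2, hy⟩ := hD.exists_isUnit_binForm h
  have hy' : IsUnit ((N * y1 ^ 2 + r * y1 * y2 + u * y2 ^ 2 : ℤ) : ZMod D.natAbs) := by
    push_cast; exact hy
  rw [ZMod.isUnit_intCast_iff_forall_prime] at hy'
  have hl' : ((N * t ^ 2 + r * t * k + u * k ^ 2 + b * s : ℤ) : ZMod D.natAbs) = 0 := by
    push_cast; exact hl
  rw [ZMod.intCast_zmod_eq_zero_iff_dvd, Int.natAbs_dvd] at hl'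
  have hlm' : IsUnit (((2 * N * t + r * k) * t' + (r * t + 2 * u * k) * k' + b * s' + s * b' : ℤ) :
      ZMod D.natAbs) := by
    convert hlm using 1
    simp only [quadPolar, binPolar]
    push_cast; ring
  rw [ZMod.isUnit_intCast_iff_forall_prime] at hlm'
  obtain ⟨X, Y, hXY⟩ := exists_forall_prime_not_dvd_form hD.natAbs_pos.ne' s
    ((2 * N * t + r * k) * y1 + (r * t + 2 * u * k) * y2)
    (-(b * (N * y1 ^ 2 + r * y1 * y2 + u * y2 ^ 2))) (by
      rintro p hp hpd ⟨hs, hb⟩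
      have hp' := Nat.prime_iff_prime_int.mp hp
      have hb' : (p : ℤ) ∣ b := (hp'.dvd_or_dvd ((dvd_neg).mp hb)).resolve_right (hy' p hp hpd)
      have hq := (dvd_add_left (hs.mul_left b)).mp ((Int.natCast_dvd.mpr hpd).trans hl')
      obtain ⟨h1, h2⟩ := Int.Prime.dvd_polar_of_dvd_form h hp (Int.natCast_dvd.mpr hpd) hq
      exact hlm' p hp hpd (dvd_add (dvd_add (dvd_add (h1.mul_right _) (h2.mul_right _))
        (hb'.mul_right _)) (hs.mul_right _)))
  refine ⟨(X, Y * y1, Y * y2), ?_⟩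
  have := (ZMod.isUnit_intCast_iff_forall_prime _).mpr hXY
  convert this using 1
  simp only [quadPolar, binPolar, isoVec, binForm]
  push_cast
  ring

lemma card_binPolar_radical_le {D : ℤ} (hD : IsFundamentalDiscriminant D) [NeZero D.natAbs]
    {N r u : ℤ} (h : r ^ 2 - 4 * N * u = D) :
    Fintype.card {v : ZMod D.natAbs × ZMod D.natAbs // ∀ w : ZMod D.natAbs × ZMod D.natAbs,
      binPolar (N : ZMod D.natAbs) r u v.1 v.2 w.1 w.2 = 0} ≤ Fintype.card (ZMod D.natAbs) := by
  obtain ⟨y1, y2, hy⟩ := hD.exists_isUnit_binForm h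
  have hα : (N : ZMod D.natAbs) * y1 ^ 2 + r * y1 * y2 + u * y2 ^ 2 =
    binForm (N : ZMod D.natAbs) r u y1 y2 := rfl
  have hB : ∀ v : {v : ZMod D.natAbs × ZMod D.natAbs // ∀ w : ZMod D.natAbs × ZMod D.natAbs,
      binPolar (N : ZMod D.natAbs) r u v.1 v.2 w.1 w.2 = 0},
      (2 * N * v.1.1 + r * v.1.2 : ZMod D.natAbs) = 0 ∧ (r * v.1.1 + 2 * u * v.1.2 : ZMod D.natAbs) = 0 := by
    intro v
    have h1 := v.2 (1, 0)
    have h2 := v.2 (0, 1)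
    simp only [binPolar] at h1 h2
    exact ⟨by linear_combination h1, by linear_combination h2⟩
  rcases Int.emod_two_eq_zero_or_one D with h2 | h2
  · obtain ⟨m, hm⟩ : ∃ m, D = 4 * m := by
      rcases hD with ⟨h3, -⟩ | ⟨h3, -⟩
      · omega
      · exact ⟨D / 4, by omega⟩
    obtain ⟨r', rfl⟩ : (2 : ℤ) ∣ r := by
      apply Int.prime_two.dvd_of_dvd_pow (n := 2)
      exact ⟨2 * m + 2 * (N * u), by linear_combination h + hm⟩
    have hm' : m = r' ^ 2 - N * u := by linarith
    have hcard : D.natAbs = 2 * (2 * m.natAbs) := by rw [hm, Int.natAbs_mul]; simp; ring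
    have hmpos : 0 < 2 * m.natAbs := by have := NeZero.pos D.natAbs; omega
    have hm0 : 4 * (m : ZMod D.natAbs) = 0 := by
      have : ((4 * m : ℤ) : ZMod D.natAbs) = 0 := by
        rw [← hm, ZMod.intCast_zmod_eq_zero_iff_dvd]
        exact Int.natAbs_dvd.mpr dvd_rfl
      simpa using this
    have hk : ∀ x : ZMod D.natAbs, 2 * (m : ZMod D.natAbs) * x = 0 → (2 * m.natAbs) • x = 0 := by
      intro x hx
      rw [nsmul_eq_mul]
      push_cast
      have h5 : ((m.natAbs : ℕ) : ZMod D.natAbs) = ((m.natAbs : ℤ) : ZMod D.natAbs) := by simp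
      rcases Int.natAbs_eq m with h3 | h3
      · rw [h5, ← h3, hx]
      · have h4 : (m.natAbs : ℤ) = -m := by omega
        rw [h5, h4]
        push_cast
        linear_combination -hx
    have c1 := IsAddCyclic.card_nsmul_eq_zero_le (α := ZMod D.natAbs) (n := 2) two_pos
    have c2 := IsAddCyclic.card_nsmul_eq_zero_le (α := ZMod D.natAbs) (n := 2 * m.natAbs) hmpos
    rw [← Fintype.card_subtype] at c1 c2
    rw [ZMod.card]
    conv_rhs => rw [hcard]
    refine le_trans ?_ (Nat.mul_le_mul c1 c2)
    rw [← Fintype.card_prod]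
    refine Fintype.card_le_of_injective (fun v =>
      (⟨N * v.1.1 * y1 + r' * (v.1.1 * y2 + v.1.2 * y1) + u * v.1.2 * y2, ?_⟩,
        ⟨y1 * v.1.2 - y2 * v.1.1, ?_⟩)) ?_
    · obtain ⟨h3, h4⟩ := hB v
      push_cast at h3 h4
      rw [nsmul_eq_mul]
      push_cast
      linear_combination (y1 : ZMod D.natAbs) * h3 + (y2 : ZMod D.natAbs) * h4
    · obtain ⟨h3, h4⟩ := hB v
      push_cast at h3 h4
      apply hk
      rw [hm']
      push_cast
      linear_combination (r' * y1 + u * y2 : ZMod D.natAbs) * h3 - (N * y1 + r' * y2 : ZMod D.natAbs) * h4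
    · intro v w hvw
      simp only [Prod.mk.injEq, Subtype.mk.injEq] at hvw
      obtain ⟨e1, e2⟩ := hvw
      apply Subtype.ext
      ext
      · apply hy.mul_left_cancel
        rw [← hα]
        push_cast
        linear_combination (y1 : ZMod D.natAbs) * e1 - (r' * y1 + u * y2 : ZMod D.natAbs) * e2
      · apply hy.mul_left_cancel
        rw [← hα]
        push_cast
        linear_combination (y2 : ZMod D.natAbs) * e1 + (N * y1 + r' * y2 : ZMod D.natAbs) * e2
  · have h2u : IsUnit (2 : ZMod D.natAbs) := by
      have : IsUnit ((2 : ℕ) : ZMod D.natAbs) := by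
        rw [ZMod.isUnit_iff_coprime, Nat.coprime_two_left, Nat.odd_iff]
        omega
      simpa using this
    refine Fintype.card_le_of_injective (fun v => (y1 : ZMod D.natAbs) * v.1.2 - y2 * v.1.1) ?_
    intro v w hvw
    obtain ⟨a1, a2⟩ := hB v
    obtain ⟨b1, b2⟩ := hB w
    simp only at hvw
    apply Subtype.ext
    ext
    · apply (h2u.mul hy).mul_left_cancel
      rw [← hα]
      linear_combination (y1 : ZMod D.natAbs) * (y1 * (a1 - b1) + y2 * (a2 - b2)) -
        (r * y1 + 2 * u * y2 : ZMod D.natAbs) * hvw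
    · apply (h2u.mul hy).mul_left_cancel
      rw [← hα]
      linear_combination (y2 : ZMod D.natAbs) * (y1 * (a1 - b1) + y2 * (a2 - b2)) +
        (2 * N * y1 + r * y2 : ZMod D.natAbs) * hvw

lemma isFormChar_fundChar {D : ℤ} (hD : IsFundamentalDiscriminant D) [NeZero D.natAbs]
    {N r u : ℤ} (hN : 0 < N) (h : r ^ 2 - 4 * N * u = D) :
    IsFormChar (N : ZMod D.natAbs) r u (fundChar hD) ZMod.stdAddChar where
  form t k hu := fundChar_form hD h hN hu
  mul_self x hx := fundChar_mul_self hD hx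
  exists_isoVec := exists_isUnit_quadPolar_isoVec hD h
  gauss k := by
    rw [sum_fundChar_mul hD]
    rfl
  norm_gauss := by rw [ZMod.card]; exact norm_fundGauss_sq hD
  primitive := ZMod.isPrimitive_stdAddChar _
  card_radical := by
    convert card_binPolar_radical_le hD h

lemma ZMod.sum_eq_sum_range {M : Type*} [AddCommMonoid M] (n : ℕ) [NeZero n] (f : ZMod n → M) :
    ∑ x, f x = ∑ i ∈ Finset.range n, f (i : ZMod n) := by
  refine (Finset.sum_nbij' (fun i : ℕ => (i : ZMod n)) ZMod.val ?_ ?_ ?_ ?_ ?_).symm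
  · exact fun _ _ => Finset.mem_univ _
  · exact fun x _ => Finset.mem_range.mpr (ZMod.val_lt x)
  · exact fun i hi => ZMod.val_cast_of_lt (Finset.mem_range.mp hi)
  · exact fun x _ => ZMod.natCast_zmod_val x
  · exact fun _ _ => rfl

lemma IsFormChar.isoChar_eq_one {R : Type*} [CommRing R] [Fintype R] {N r u : R} {χ : MulChar R ℂ}
    {ε : AddChar R ℂ} (H : IsFormChar N r u χ ε) (t h : R) :
    isoChar N r u χ (t, h, -binForm N r u t h, 1) = 1 := by
  have h0 : quadForm N r u ((0, 0, 1, 0) : R × R × R × R) = 0 := by simp [quadForm, binForm]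
  have h1 : quadForm N r u (t, h, -binForm N r u t h, 1) = 0 := by simp [quadForm]
  have h2 : quadPolar N r u (t, h, -binForm N r u t h, 1) (0, 0, 1, 0) = 1 := by
    simp [quadPolar, binPolar]
  have h3 := H.isoChar_mul_isoChar h1 h0 (by rw [h2]; exact isUnit_one)
  obtain ⟨z, hz, hz'⟩ := H.exists_eq h0 ⟨(t, h, -binForm N r u t h, 1), by
    rw [quadPolar_comm, h2]; exact isUnit_one⟩
  have h4 : quadPolar N r u (0, 0, 1, 0) (isoVec N r u z) = -1 * binForm N r u z.2.1 z.2.2 := by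
    simp [quadPolar, binPolar, isoVec]
  rw [h4] at hz hz'
  rw [map_mul, H.form _ _ (isUnit_of_mul_isUnit_right hz), mul_one] at hz'
  rw [h2, hz'] at h3
  have h5 := H.mul_self (-1) isUnit_one.neg
  linear_combination χ (-1) * h3 + (1 - isoChar N r u χ (t, h, -binForm N r u t h, 1)) * h5

lemma IsFormChar.gaussSum_mul_card {R : Type*} [CommRing R] [Fintype R] {N r u : R}
    {χ : MulChar R ℂ} {ε : AddChar R ℂ} (H : IsFormChar N r u χ ε) :
    gaussSum χ ε * Fintype.card R = ∑ t, ∑ h, ε (binForm N r u t h) := by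
  have h1 := H.partial_fourier 0 0 1 1
  have h0 : ∑ β, isoChar N r u χ (0, 0, β, 1) * ε (β * 1) = 1 := by
    rw [Finset.sum_eq_single 0]
    · have h2 := H.isoChar_eq_one 0 0
      simp only [binForm] at h2
      simp only [mul_zero, add_zero, zero_pow two_ne_zero, neg_zero] at h2
      rw [h2, zero_mul, AddChar.map_zero_eq_one, mul_one]
    · intro β _ hβ
      rw [isoChar_eq_zero, zero_mul]
      rintro ⟨h3, -⟩
      simp [quadForm, binForm, hβ] at h3
    · simp
  rw [h0, mul_one] at h1
  rw [← h1]
  refine Finset.sum_congr rfl fun t _ => Finset.sum_congr rfl fun h _ => ?_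
  rw [Finset.sum_eq_single (-binForm N r u t h)]
  · rw [H.isoChar_eq_one]
    simp [binPolar]
  · intro b _ hb
    rw [isoChar_eq_zero, zero_mul]
    rintro ⟨h3, -⟩
    apply hb
    simp only [quadForm, mul_one] at h3
    linear_combination h3
  · simp

lemma sum_range_two_mul_ite (k : ℕ) (x y : ℂ) :
    ∑ t ∈ Finset.range (2 * k), (if t % 2 = 0 then x else y) = k * (x + y) := by
  induction k with
  | zero => simp
  | succ k ih =>
    rw [mul_add, mul_one, Finset.sum_range_succ, Finset.sum_range_succ, ih, if_pos (by omega),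
      if_neg (by omega)]
    push_cast
    ring

lemma sum_stdAddChar_sq (d : ℕ) [NeZero d] :
    ∑ t : ZMod d, ZMod.stdAddChar (t ^ 2) =
      (Real.sqrt d : ℂ) * ((1 + I) / 2) * (1 + (-I) ^ d) := by
  rw [← quadratic_gauss_sum, ZMod.sum_eq_sum_range]
  refine Finset.sum_congr rfl fun t _ => ?_
  have := ZMod.stdAddChar_coe (N := d) ((t : ℤ) ^ 2)
  push_cast at this
  rw [this]
  congr 1
  ring

lemma neg_I_pow_mod_four (d : ℕ) : (-I) ^ d = (-I) ^ (d % 4) := by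
  conv_lhs => rw [← Nat.div_add_mod d 4, pow_add, pow_mul]
  have : (-I) ^ 4 = 1 := by rw [neg_pow, I_pow_four]; norm_num
  rw [this, one_pow, one_mul]

lemma sum_stdAddChar_neg_mul_sq {m : ℤ} (hm : m ≠ 0) [NeZero (4 * m).natAbs] :
    ∑ t : ZMod (4 * m).natAbs, ZMod.stdAddChar (-(m : ZMod (4 * m).natAbs) * t ^ 2) =
      (4 * m).natAbs * ((1 - (m.sign : ℂ) * I) / 2) := by
  have hF : ∀ t : ℕ, ZMod.stdAddChar (-(m : ZMod (4 * m).natAbs) * (t : ZMod (4 * m).natAbs) ^ 2) =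
      if t % 2 = 0 then 1 else -((m.sign : ℂ) * I) := by
    intro t
    have h1 := ZMod.stdAddChar_coe (N := (4 * m).natAbs) (-m * (t : ℤ) ^ 2)
    push_cast at h1
    rw [h1]
    have hd : (((4 * m).natAbs : ℕ) : ℂ) = 4 * m * m.sign := by
      have : (((4 * m).natAbs : ℕ) : ℤ) = 4 * m * m.sign := by
        rw [Int.natAbs_mul, mul_assoc, Int.mul_sign_self]; simp
      have h2 := congrArg (Int.cast : ℤ → ℂ) this
      rw [Int.cast_natCast] at h2
      rw [h2]
      push_cast
      rfl
    have hm' : (m : ℂ) ≠ 0 := by exact_mod_cast hm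
    have hs : (m.sign : ℂ) * m.sign = 1 := by
      have : m.sign * m.sign = 1 := by rcases hm.lt_or_gt with h | h <;> simp [Int.sign_eq_one_of_pos, Int.sign_eq_neg_one_of_neg, h]
      exact_mod_cast congrArg (Int.cast : ℤ → ℂ) this
    have hs0 : (m.sign : ℂ) ≠ 0 := left_ne_zero_of_mul_eq_one hs
    have h2 : 2 * (Real.pi : ℂ) * I * (-m * (t : ℂ) ^ 2) / ((4 * m).natAbs : ℕ) =
        -(m.sign : ℂ) * (Real.pi / 2 * I) * (t : ℂ) ^ 2 := by
      rw [hd]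
      field_simp
      linear_combination 4 * (t : ℂ) ^ 2 * hs
    rw [h2]
    rcases Nat.even_or_odd' t with ⟨j, rfl | rfl⟩
    · rw [if_pos (by omega), ← Complex.exp_int_mul_two_pi_mul_I (-m.sign * j ^ 2)]
      congr 1
      push_cast
      ring
    · rw [if_neg (by omega)]
      have h3 : -(m.sign : ℂ) * (Real.pi / 2 * I) * ((2 * j + 1 : ℕ) : ℂ) ^ 2 =
          ((-m.sign * (j ^ 2 + j) : ℤ) : ℂ) * (2 * Real.pi * I) +
            -(m.sign : ℂ) * (Real.pi / 2 * I) := by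
        push_cast
        ring
      rw [h3, Complex.exp_add, Complex.exp_int_mul_two_pi_mul_I, one_mul]
      rcases hm.lt_or_gt with h | h
      · rw [Int.sign_eq_neg_one_of_neg h]
        simp [Complex.exp_pi_div_two_mul_I]
      · rw [Int.sign_eq_one_of_pos h]
        simp [Complex.exp_neg, Complex.exp_pi_div_two_mul_I]
  rw [ZMod.sum_eq_sum_range, Finset.sum_congr rfl fun t _ => hF t]
  have h4 : (4 * m).natAbs = 2 * (2 * m.natAbs) := by rw [Int.natAbs_mul]; simp; ring
  rw [h4, sum_range_two_mul_ite]
  push_cast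
  ring

lemma fundGauss_eq {D : ℤ} (hD : IsFundamentalDiscriminant D) :
    fundGauss hD = (if 0 < D then 1 else I) * (Real.sqrt D.natAbs : ℂ) := by
  have hd0 := hD.natAbs_pos
  have : NeZero D.natAbs := ⟨hd0.ne'⟩
  have hdC : (D.natAbs : ℂ) ≠ 0 := by exact_mod_cast hd0.ne'
  have h2I : (1 + I) * (1 - I) = 2 := by linear_combination -I_mul_I
  have h2I' : (1 + I) * (1 + I) = 2 * I := by linear_combination I_mul_I
  rcases hD with ⟨h1, h1'⟩ | ⟨h0, hm, hm'⟩
  · have hD' : IsFundamentalDiscriminant D := Or.inl ⟨h1, h1'⟩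
    obtain ⟨v, hv⟩ : ∃ v : ℤ, D = 4 * v + 1 := ⟨D / 4, by omega⟩
    have H := isFormChar_fundChar hD' (N := 1) (r := 1) (u := -v) one_pos (by rw [hv]; ring)
    have key := H.gaussSum_mul_card
    have h2u : IsUnit (2 : ZMod D.natAbs) := by
      have : IsUnit ((2 : ℕ) : ZMod D.natAbs) := by
        rw [ZMod.isUnit_iff_coprime, Nat.coprime_two_left, Nat.odd_iff]
        omega
      simpa using this
    obtain ⟨w, hw⟩ := h2u.exists_right_inv
    have hD0 : (4 * v + 1 : ZMod D.natAbs) = 0 := by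
      have : ((4 * v + 1 : ℤ) : ZMod D.natAbs) = 0 := by
        rw [← hv, ZMod.intCast_zmod_eq_zero_iff_dvd]
        exact Int.natAbs_dvd.mpr dvd_rfl
      push_cast at this
      exact this
    have hq : ∀ t k : ZMod D.natAbs, binForm ((1 : ℤ) : ZMod D.natAbs) ((1 : ℤ) : ZMod D.natAbs)
        ((-v : ℤ) : ZMod D.natAbs) t k = (t + w * k) ^ 2 := by
      intro t k
      simp only [binForm]
      push_cast
      linear_combination (k ^ 2 * v * (2 * w + 1) - t * k) * hw - k ^ 2 * w ^ 2 * hD0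
    rw [Finset.sum_comm] at key
    have h3 : ∀ k : ZMod D.natAbs, ∑ t, ZMod.stdAddChar (binForm ((1 : ℤ) : ZMod D.natAbs)
        ((1 : ℤ) : ZMod D.natAbs) ((-v : ℤ) : ZMod D.natAbs) t k) =
          ∑ t : ZMod D.natAbs, ZMod.stdAddChar (t ^ 2) := by
      intro k
      rw [← Equiv.sum_comp (Equiv.addRight (w * k)) fun t => ZMod.stdAddChar (t ^ 2)]
      exact Finset.sum_congr rfl fun t _ => by rw [hq]; rfl
    simp only [h3] at key
    rw [Finset.sum_const, Finset.card_univ, ZMod.card, nsmul_eq_mul, mul_comm,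
      sum_stdAddChar_sq] at key
    have := mul_left_cancel₀ hdC key
    refine Eq.trans this ?_
    rw [neg_I_pow_mod_four]
    split_ifs with hpos
    · have : D.natAbs % 4 = 1 := by omega
      rw [this]
      linear_combination (Real.sqrt D.natAbs : ℂ) / 2 * h2I
    · have : D.natAbs % 4 = 3 := by omega
      rw [this]
      linear_combination (Real.sqrt D.natAbs : ℂ) / 2 * h2I' - (Real.sqrt D.natAbs : ℂ) * (1 + I) / 2 * I * I_sq
  · have hD' : IsFundamentalDiscriminant D := Or.inr ⟨h0, hm, hm'⟩
    obtain ⟨m, rfl⟩ : ∃ m, D = 4 * m := ⟨D / 4, by omega⟩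
    have hm0 : m ≠ 0 := by rintro rfl; simp at hd0
    have H := isFormChar_fundChar hD' (N := 1) (r := 0) (u := -m) one_pos (by ring)
    have key := H.gaussSum_mul_card
    have hq : ∀ t k : ZMod (4 * m).natAbs, ZMod.stdAddChar (binForm ((1 : ℤ) : ZMod (4 * m).natAbs)
        ((0 : ℤ) : ZMod (4 * m).natAbs) ((-m : ℤ) : ZMod (4 * m).natAbs) t k) =
        ZMod.stdAddChar (t ^ 2) * ZMod.stdAddChar (-(m : ZMod (4 * m).natAbs) * k ^ 2) := by
      intro t k
      rw [← AddChar.map_add_eq_mul]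
      congr 1
      simp only [binForm]
      push_cast
      ring
    simp only [hq] at key
    rw [← Fintype.sum_mul_sum, ZMod.card, sum_stdAddChar_sq, sum_stdAddChar_neg_mul_sq hm0] at key
    rw [mul_comm, mul_left_comm] at key
    have := mul_left_cancel₀ hdC key
    refine Eq.trans this ?_
    rw [neg_I_pow_mod_four]
    have : (4 * m).natAbs % 4 = 0 := by omega
    rw [this]
    split_ifs with hpos
    · rw [Int.sign_eq_one_of_pos (by omega)]
      push_cast
      linear_combination (Real.sqrt (4 * m).natAbs : ℂ) / 2 * h2I
    · rw [Int.sign_eq_neg_one_of_neg (by omega)]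
      push_cast
      linear_combination (Real.sqrt (4 * m).natAbs : ℂ) / 2 * h2I'

lemma fundChar_neg_one {D : ℤ} (hD : IsFundamentalDiscriminant D) :
    fundChar hD (-1) = if 0 < D then 1 else -1 := by
  have h1 := fundGauss_sq hD
  rw [fundGauss_eq hD, mul_pow, ← Complex.ofReal_pow, Real.sq_sqrt (by positivity)] at h1
  have hd : ((D.natAbs : ℝ) : ℂ) ≠ 0 := by exact_mod_cast hD.natAbs_pos.ne'
  rw [← Complex.ofReal_natCast] at h1
  rw [← mul_right_cancel₀ hd h1]
  split_ifs <;> simp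

lemma fundChar_apply_intCast {D : ℤ} (hD : IsFundamentalDiscriminant D) {n : ℤ}
    (hc : Int.gcd n D = 1) : fundChar hD (n : ZMod D.natAbs) = kronecker D n := by
  have hD0 : D ≠ 0 := hD.ne_zero
  have hnat : ∀ m : ℕ, m.Coprime D.natAbs → fundChar hD (m : ZMod D.natAbs) = kronecker D m := by
    intro m hm
    rcases eq_or_ne m 0 with rfl | h0
    · have h1 : D.natAbs = 1 := by simpa using hm
      have h2 : ((0 : ℕ) : ZMod D.natAbs) = 1 := by
        have : Subsingleton (ZMod D.natAbs) := by rw [h1]; infer_instance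
        exact Subsingleton.elim _ _
      rw [h2, map_one, kronecker, if_pos (by simp), if_pos (by omega)]
      simp
    · exact fundChar_apply_natCast hD h0 hm
  rcases Int.natAbs_eq n with h | h
  · rw [h, Int.cast_natCast]
    exact hnat _ hc
  · rcases Nat.eq_zero_or_pos n.natAbs with h0 | h0
    · have : n = 0 := Int.natAbs_eq_zero.mp h0
      subst this
      simpa using hnat 0 (by simpa using hc)
    · have h1 : kronecker D n = (if D < 0 then -1 else 1) * kronecker D n.natAbs := by
        have h2 : n ≠ 0 := by omega
        have h3 : ((n.natAbs : ℕ) : ℤ) ≠ 0 := by omega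
        have h4 : ¬ ((n.natAbs : ℤ) < 0 ∧ D < 0) := by omega
        have h5 : (n < 0 ∧ D < 0) ↔ D < 0 := by omega
        simp only [kronecker, if_neg h2, if_neg h3, if_neg h4, Int.natAbs_natCast, h5]
        ring
      rw [h1]
      conv_lhs => rw [h, Int.cast_neg, Int.cast_natCast, ← neg_one_mul, map_mul, hnat _ hc,
        fundChar_neg_one]
      push_cast
      congr 1
      split_ifs <;> first | rfl | omega

lemma IsFundamentalDiscriminant.exists_mul_eq {D : ℤ} (hD : IsFundamentalDiscriminant D)
    {N r u : ℤ} (hN : 0 < N) (h : r ^ 2 - 4 * N * u = D) (s : ℤ) :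
    ∃ N₁ N₂ : ℤ, N₁ * N₂ = N ∧ 0 < N₁ ∧ 0 < N₂ ∧ ∀ p : ℕ, p.Prime → p ∣ D.natAbs →
      (((p : ℤ) ∣ s → ¬ (p : ℤ) ∣ N₁) ∧ (¬ (p : ℤ) ∣ s → ¬ (p : ℤ) ∣ N₂)) := by
  let S := (N.natAbs.gcd D.natAbs).primeFactors.filter fun p : ℕ => (p : ℤ) ∣ s
  have hS : ∀ p ∈ S, p.Prime ∧ p ∣ N.natAbs ∧ p ∣ D.natAbs ∧ (p : ℤ) ∣ s := by
    intro p hp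
    obtain ⟨h1, h2⟩ := Finset.mem_filter.mp hp
    have h3 := Nat.dvd_of_mem_primeFactors h1
    exact ⟨Nat.prime_of_mem_primeFactors h1, h3.trans (Nat.gcd_dvd_left _ _),
      h3.trans (Nat.gcd_dvd_right _ _), h2⟩
  have hdvd : ∏ p ∈ S, p ∣ N.natAbs := by
    refine Finset.prod_primes_dvd _ (fun p hp => (hS p hp).1.prime) fun p hp => (hS p hp).2.1
  obtain ⟨M, hM⟩ := hdvd
  have hNpos : 0 < N.natAbs := by omega
  rw [hM] at hNpos
  have hN' : N = ((∏ p ∈ S, p : ℕ) : ℤ) * M := by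
    have : (N.natAbs : ℤ) = N := by omega
    rw [← this, hM]
    push_cast
    rfl
  refine ⟨M, (∏ p ∈ S, p : ℕ), by rw [hN', mul_comm], by
    exact_mod_cast Nat.pos_of_mul_pos_left hNpos, by exact_mod_cast Nat.pos_of_mul_pos_right hNpos, ?_⟩
  intro p hp hpd
  constructor
  · intro hps hpM
    have hpN : p ∣ N.natAbs := by
      rw [hM]; exact (Int.natCast_dvd_natCast.mp hpM).mul_left _
    have hpS : p ∈ S := by
      refine Finset.mem_filter.mpr ⟨Nat.mem_primeFactors.mpr ⟨hp, Nat.dvd_gcd hpN hpd, ?_⟩, hps⟩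
      exact (Nat.gcd_pos_of_pos_right _ hD.natAbs_pos).ne'
    obtain ⟨P, hP⟩ := Finset.dvd_prod_of_mem (fun p : ℕ => p) hpS
    obtain ⟨M', rfl⟩ := Int.natCast_dvd_natCast.mp hpM
    refine hD.not_dvd_and_dvd (N := p * (P * M')) (r := r) (u := p * u) ?_ hp
      (Int.natCast_dvd.mpr hpd) ⟨dvd_mul_right _ _, dvd_mul_right _ _⟩
    rw [← h, hN', hP]
    push_cast
    ring
  · intro hps hpP
    obtain ⟨q, hq, hpq⟩ := (Prime.dvd_finsetProd_iff hp.prime _).mp (Int.natCast_dvd_natCast.mp hpP)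
    have : p = q := (Nat.prime_dvd_prime_iff_eq hp (hS q hq).1).mp hpq
    exact hps (this ▸ (hS q hq).2.2.2)

lemma genusChar_eq_isoChar {N : ℕ} (hN : 0 < N) {Δ : ℤ} (hΔ : IsFundamentalDiscriminant Δ)
    [NeZero Δ.natAbs] {r u : ℤ} (hr : r ^ 2 - 4 * (N : ℤ) * u = Δ)
    {χ : ℤ → ℤ → ℤ → ℤ} (hχ : IsGenusChar N Δ χ) {t h b s x : ℤ} (hx : x = 2 * N * t + r * h) :
    (if x ^ 2 + 4 * (N : ℤ) * b * s ≡ Δ * h ^ 2 [ZMOD (4 * (N : ℤ) * Δ)] then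
      (χ (-b) x s : ℂ) else 0) =
    isoChar ((N : ℤ) : ZMod Δ.natAbs) r u (fundChar hΔ) (t, h, b, s) := by
  have hN' : (0 : ℤ) < N := by exact_mod_cast hN
  have H := isFormChar_fundChar hΔ hN' hr
  have hiff : x ^ 2 + 4 * (N : ℤ) * b * s ≡ Δ * h ^ 2 [ZMOD (4 * (N : ℤ) * Δ)] ↔
      Δ ∣ N * t ^ 2 + r * t * h + u * h ^ 2 + b * s := by
    rw [Int.modEq_comm, Int.modEq_iff_dvd]
    have : x ^ 2 + 4 * (N : ℤ) * b * s - Δ * h ^ 2 =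
      4 * (N : ℤ) * (N * t ^ 2 + r * t * h + u * h ^ 2 + b * s) := by
      rw [← hr, hx]; ring
    rw [this]
    exact mul_dvd_mul_iff_left (by positivity)
  have hform : quadForm ((N : ℤ) : ZMod Δ.natAbs) r u (t, h, b, s) =
      ((N * t ^ 2 + r * t * h + u * h ^ 2 + b * s : ℤ) : ZMod Δ.natAbs) := by
    simp only [quadForm, binForm]
    push_cast
    ring
  by_cases hq : Δ ∣ N * t ^ 2 + r * t * h + u * h ^ 2 + b * s
  swap
  · rw [if_neg (hiff.not.mpr hq), isoChar_eq_zero]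
    rintro ⟨h1, -⟩
    rw [hform, ZMod.intCast_zmod_eq_zero_iff_dvd, Int.natAbs_dvd] at h1
    exact hq h1
  rw [if_pos (hiff.mpr hq)]
  have hl : quadForm ((N : ℤ) : ZMod Δ.natAbs) r u (t, h, b, s) = 0 := by
    rw [hform, ZMod.intCast_zmod_eq_zero_iff_dvd, Int.natAbs_dvd]
    exact hq
  by_cases hbs : ∃ p : ℕ, p.Prime ∧ p ∣ Δ.natAbs ∧ (p : ℤ) ∣ b ∧ (p : ℤ) ∣ s
  · obtain ⟨p, hp, hpd, hb, hs⟩ := hbs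
    have hpΔ : (p : ℤ) ∣ Δ := Int.natCast_dvd.mpr hpd
    have hpq := (dvd_add_left (hs.mul_left b)).mp (hpΔ.trans hq)
    obtain ⟨h1, h2⟩ := Int.Prime.dvd_polar_of_dvd_form hr hp hpΔ hpq
    rw [hχ.2.1, isoChar_eq_zero]
    · exact Int.cast_zero
    · rintro ⟨-, ⟨t', k', b', s'⟩, hm⟩
      obtain ⟨t', rfl⟩ := ZMod.intCast_surjective t'
      obtain ⟨k', rfl⟩ := ZMod.intCast_surjective k'
      obtain ⟨b', rfl⟩ := ZMod.intCast_surjective b'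
      obtain ⟨s', rfl⟩ := ZMod.intCast_surjective s'
      have hm' : IsUnit (((2 * N * t + r * h) * t' + (r * t + 2 * u * h) * k' + b * s' + s * b' : ℤ) :
          ZMod Δ.natAbs) := by
        convert hm using 1
        simp only [quadPolar, binPolar]
        push_cast; ring
      rw [ZMod.isUnit_intCast_iff_forall_prime] at hm'
      exact hm' p hp hpd (dvd_add (dvd_add (dvd_add (h1.mul_right _) (h2.mul_right _))
        (hb.mul_right _)) (hs.mul_right _))
    · rintro ⟨-, -, hgcd⟩
      have : (p : ℤ) ∣ ((Int.gcd (Int.gcd (Int.gcd (-b) x) s) Δ : ℕ) : ℤ) :=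
        Int.dvd_coe_gcd (Int.dvd_coe_gcd (Int.dvd_coe_gcd ((dvd_neg).mpr hb) (hx ▸ h1)) hs) hpΔ
      rw [hgcd] at this
      exact hp.not_dvd_one (by exact_mod_cast this)
  · push Not at hbs
    have hcond : GenusCharCond N Δ (-b) x s := by
      obtain ⟨k, hk⟩ := hq
      have hQ : QD N (-b) x s = Δ * (h ^ 2 + 4 * N * k) := by
        rw [QD, hx]
        linear_combination 4 * (N : ℤ) * hk + h ^ 2 * hr
      refine ⟨⟨_, hQ⟩, ⟨h, ?_⟩, ?_⟩
      · rw [hQ, Int.mul_ediv_cancel_left _ hΔ.ne_zero]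
        exact (Int.modEq_iff_dvd.mpr ⟨-k, by ring⟩)
      · by_contra hne
        obtain ⟨p, hp, hpd⟩ := Nat.exists_prime_and_dvd hne
        have hp' : (p : ℤ) ∣ ((Int.gcd (Int.gcd (Int.gcd (-b) x) s) Δ : ℕ) : ℤ) := by
          exact_mod_cast hpd
        have h1 := hp'.trans (Int.gcd_dvd_left _ _)
        have h2 := (h1.trans (Int.gcd_dvd_left _ _)).trans (Int.gcd_dvd_left _ _)
        exact hbs p hp (Int.natCast_dvd.mp (hp'.trans (Int.gcd_dvd_right _ _))) ((dvd_neg).mp h2)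
          (h1.trans (Int.gcd_dvd_right _ _))
    obtain ⟨N₁, N₂, hNN, hN₁, hN₂, hpN⟩ := hΔ.exists_mul_eq hN' hr s
    obtain ⟨X, Y, hXY⟩ := exists_forall_prime_not_dvd_form hΔ.natAbs_pos.ne' (N₁ * (-b)) x (N₂ * s) (by
      rintro p hp hpd ⟨h1, h2⟩
      have hp' := Nat.prime_iff_prime_int.mp hp
      by_cases hs : (p : ℤ) ∣ s
      · refine hbs p hp hpd ((dvd_neg).mp ((hp'.dvd_or_dvd h1).resolve_left ((hpN p hp hpd).1 hs))) hs
      · exact (hp'.dvd_or_dvd h2).elim ((hpN p hp hpd).2 hs) hs)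
    obtain ⟨X', Y', hXY'⟩ := exists_forall_prime_not_dvd_form hΔ.natAbs_pos.ne' s 0 b
      fun p hp hpd hh => hbs p hp hpd hh.2 hh.1
    rw [← ZMod.isUnit_intCast_iff_forall_prime] at hXY'
    have hu := (ZMod.isUnit_intCast_iff_forall_prime _).mpr hXY
    obtain ⟨z, hz, hz'⟩ := H.exists_eq hl ⟨(0, 0, ((X' ^ 2 : ℤ) : ZMod Δ.natAbs),
      ((Y' ^ 2 : ℤ) : ZMod Δ.natAbs)), by
        convert hXY' using 1
        simp only [quadPolar, binPolar]
        push_cast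
        ring⟩
    have hgcd : Int.gcd (N₁ * (-b) * X ^ 2 + x * X * Y + N₂ * s * Y ^ 2) Δ = 1 :=
      Nat.coprime_of_dvd fun p hp h1 h2 => hXY p hp h2 (Int.natCast_dvd.mpr h1)
    rw [hχ.2.2 (-b) x s _ hcond hgcd ⟨N₁, N₂, X, Y, hNN, hN₁, hN₂, rfl⟩,
      ← fundChar_apply_intCast hΔ hgcd, hz']
    have hNR : ((N : ℤ) : ZMod Δ.natAbs) = (N₁ : ZMod Δ.natAbs) * N₂ := by
      rw [← hNN]; push_cast; rfl
    rw [hNR] at hl hz ⊢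
    obtain ⟨t₀, h₀, hform⟩ := exists_form_eq_of_isotropic _ _ hl z (X : ZMod Δ.natAbs) Y
    have hn : ((N₁ * (-b) * X ^ 2 + x * X * Y + N₂ * s * Y ^ 2 : ℤ) : ZMod Δ.natAbs) =
        -(N₁ * b) * X ^ 2 + (2 * (N₁ * N₂) * t + r * h) * X * Y + N₂ * s * Y ^ 2 := by
      rw [hx, ← hNN]
      push_cast
      ring
    rw [← hn] at hform
    have hone := fundChar_form hΔ (A := N₂) (B := r) (C := N₁ * u) (by rw [← hr, ← hNN]; ring) hN₂
      (t := t₀) (h := h₀) (by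
        have := hu.mul hz
        rw [← hform, binForm] at this
        push_cast
        exact this)
    rw [binForm] at hform
    push_cast at hone
    rw [hform, map_mul] at hone
    linear_combination (fundChar hΔ (quadPolar ((N₁ : ZMod Δ.natAbs) * N₂) r u (t, h, b, s)
      (isoVec ((N₁ : ZMod Δ.natAbs) * N₂) r u z))) * hone -
        (fundChar hΔ ((N₁ * (-b) * X ^ 2 + x * X * Y + N₂ * s * Y ^ 2 : ℤ) : ZMod Δ.natAbs)) *
          fundChar_mul_self hΔ hz

lemma e_add (x y : ℂ) : e (x + y) = e x * e y := by
  rw [e, e, e, ← Complex.exp_add, mul_add]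

lemma e_eq_one_iff {x : ℂ} : e x = 1 ↔ ∃ n : ℤ, x = n := by
  rw [e, Complex.exp_eq_one_iff]
  refine exists_congr fun n => ?_
  rw [mul_comm, mul_left_inj' Complex.two_pi_I_ne_zero]

lemma e_intCast (n : ℤ) : e n = 1 := e_eq_one_iff.mpr ⟨n, rfl⟩

lemma e_eq_of_sub_eq_intCast {x y : ℂ} (n : ℤ) (h : x - y = n) : e x = e y := by
  rw [← sub_add_cancel x y, e_add, h, e_intCast, one_mul]

lemma e_natCast_mul (n : ℕ) (x : ℂ) : e (n * x) = e x ^ n := by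
  rw [e, e, ← Complex.exp_nat_mul]
  congr 1
  ring

lemma stdAddChar_intCast_eq_e {d : ℕ} [NeZero d] (j : ℤ) :
    ZMod.stdAddChar (j : ZMod d) = e ((j : ℂ) / d) := by
  rw [ZMod.stdAddChar_coe, e, mul_div_assoc]

lemma sum_range_add_of_periodic {M : ℕ} {g : ℤ → ℂ} (hg : Function.Periodic g M) (j : ℤ) :
    ∑ t ∈ Finset.range M, g (t + j) = ∑ t ∈ Finset.range M, g t := by
  have step : ∀ j : ℤ, ∑ t ∈ Finset.range M, g (t + (j + 1)) = ∑ t ∈ Finset.range M, g (t + j) := by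
    intro j
    have h1 := Finset.sum_range_succ (fun t : ℕ => g (t + j)) M
    rw [Finset.sum_range_succ'] at h1
    have h2 : g ((M : ℤ) + j) = g (((0 : ℕ) : ℤ) + j) := by
      rw [add_comm, hg]; simp
    rw [h2] at h1
    rw [← add_right_cancel h1]
    refine Finset.sum_congr rfl fun t _ => ?_
    congr 1
    push_cast
    ring
  induction j with
  | zero => simp
  | succ j ih => rw [step, ih]
  | pred j ih => rw [← ih, ← step, sub_add_cancel]

lemma sum_range_mul_of_periodic {M : ℕ} {g : ℤ → ℂ} (hg : Function.Periodic g M) (n : ℕ) :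
    ∑ t ∈ Finset.range (M * n), g t = n * ∑ t ∈ Finset.range M, g t := by
  induction n with
  | zero => simp
  | succ n ih =>
    rw [mul_add, mul_one, Finset.sum_range_add, ih, ← sum_range_add_of_periodic hg (M * n)]
    push_cast
    rw [add_mul, one_mul]
    congr 1
    exact Finset.sum_congr rfl fun t _ => by rw [add_comm]

lemma sum_range_mul_ite_modEq {M : ℕ} (hM : 0 < M) (d : ℕ) {f : ℤ → ℂ}
    (hf : Function.Periodic f ((M : ℤ) * d)) (ρ : ℤ) :
    ∑ x ∈ Finset.range (M * d), (if (x : ℤ) ≡ ρ [ZMOD M] then f x else 0) =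
      ∑ t ∈ Finset.range d, f (M * t + ρ) := by
  have hM' : (0 : ℤ) < M := by exact_mod_cast hM
  have h1 : ∀ n : ℕ, ∑ x ∈ Finset.range (M * n), (if (x : ℤ) ≡ ρ [ZMOD M] then f x else 0) =
      ∑ t ∈ Finset.range n, f (M * t + ρ % M) := by
    intro n
    induction n with
    | zero => simp
    | succ n ih =>
      rw [mul_add, mul_one, Finset.sum_range_add, ih, Finset.sum_range_succ]
      congr 1
      have h2 : ((ρ % M).toNat : ℤ) = ρ % M := Int.toNat_of_nonneg (Int.emod_nonneg _ hM'.ne')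
      rw [Finset.sum_eq_single (ρ % M).toNat]
      · push_cast
        rw [h2, if_pos]
        rw [Int.ModEq, Int.mul_add_emod_self_left, Int.emod_emod_of_dvd _ dvd_rfl]
      · intro x hx hne
        rw [if_neg]
        intro h3
        push_cast at h3
        rw [Int.ModEq, Int.mul_add_emod_self_left,
          Int.emod_eq_of_lt (by positivity) (by exact_mod_cast Finset.mem_range.mp hx)] at h3
        omega
      · intro h3
        exact absurd (Finset.mem_range.mpr (by have := Int.emod_lt_of_pos ρ hM'; omega)) h3
  rw [h1]
  have hg : Function.Periodic (fun t : ℤ => f (M * t + ρ % M)) d := by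
    intro t
    change f (M * (t + d) + ρ % M) = f (M * t + ρ % M)
    rw [← hf (M * t + ρ % M)]
    congr 1
    ring
  rw [← sum_range_add_of_periodic hg (ρ / M)]
  refine Finset.sum_congr rfl fun t _ => ?_
  congr 1
  linear_combination Int.emod_add_mul_ediv ρ M

lemma sum_e_eq_ite {M : ℕ} (hM : 0 < M) {σ : ℤ} (hσ : σ = 1 ∨ σ = -1) {k : ℕ} (hk : k < M) :
    ∑ j ∈ Finset.range M, e ((σ : ℂ) * k * j / M) = if k = 0 then (M : ℂ) else 0 := by
  have hM0 : (M : ℂ) ≠ 0 := by exact_mod_cast hM.ne'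
  split_ifs with h0
  · subst h0
    simp [e]
  · have h1 : ∀ j : ℕ, e ((σ : ℂ) * k * j / M) = e ((σ : ℂ) * k / M) ^ j := by
      intro j
      rw [← e_natCast_mul]
      congr 1
      ring
    have h2 : e ((σ : ℂ) * k / M) ≠ 1 := by
      rw [Ne, e_eq_one_iff]
      rintro ⟨n, hn⟩
      rw [div_eq_iff hM0] at hn
      have hn' : σ * k = n * M := by exact_mod_cast hn
      have h3 : (M : ℤ) ∣ k := by
        rcases hσ with rfl | rfl
        · exact ⟨n, by linarith⟩
        · exact ⟨-n, by linarith⟩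
      exact h0 (Nat.eq_zero_of_dvd_of_lt (Int.natCast_dvd_natCast.mp h3) hk)
    simp only [h1]
    have h4 : e ((σ : ℂ) * k / M) ^ M = 1 := by
      rw [← h1, mul_div_cancel_right₀ _ hM0]
      exact_mod_cast e_intCast (σ * k)
    rw [geom_sum_eq h2, h4, sub_self, zero_div]

lemma sum_ite_modEq_eq_of_quasiperiodic {M d : ℕ} (hM : 0 < M) (hd : 0 < d) {σ : ℤ}
    (hσ : σ = 1 ∨ σ = -1) (κ r : ℤ) {S A : ℤ → ℂ} (hS : Function.Periodic S M)
    (hSr : ∀ k, S (k - r) = e ((σ : ℂ) * κ / M) * S k)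
    (hper : ∀ j : ℤ, κ ≡ r * j [ZMOD M] →
      Function.Periodic (fun k : ℤ => S k * e ((σ : ℂ) * k * j / M)) d)
    (hA : ∀ j : ℤ, κ ≡ r * j [ZMOD M] →
      d * A j = ∑ k ∈ Finset.range d, S k * e ((σ : ℂ) * k * j / M)) (h : ℤ) :
    ∑ j ∈ Finset.range M, (if κ ≡ r * j [ZMOD M] then e (-(σ : ℂ) * h * j / M) * A j else 0) =
      S h := by
  have hM0 : (M : ℂ) ≠ 0 := by exact_mod_cast hM.ne'
  have hd0 : (d : ℂ) ≠ 0 := by exact_mod_cast hd.ne'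
  have hT : ∀ j : ℤ, Function.Periodic (fun k : ℤ => S k * e ((σ : ℂ) * k * j / M)) M := by
    intro j k
    change S (k + M) * e (σ * ((k + M : ℤ) : ℂ) * j / M) = S k * e (σ * k * j / M)
    rw [hS]
    congr 1
    apply e_eq_of_sub_eq_intCast (σ * j)
    push_cast
    field_simp
    ring
  have hc : ∀ j : ℕ, (M : ℂ) * (if κ ≡ r * j [ZMOD M] then e (-(σ : ℂ) * h * j / M) * A j else 0) =
      e (-(σ : ℂ) * h * j / M) * ∑ k ∈ Finset.range M, S k * e ((σ : ℂ) * k * j / M) := by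
    intro j
    split_ifs with hj
    · have h1 := sum_range_mul_of_periodic (hT j) d
      have h2 := sum_range_mul_of_periodic (hper j hj) M
      rw [mul_comm d M, h1] at h2
      simp only [Int.cast_natCast] at h2
      have h3 := hA j hj
      simp only [Int.cast_natCast] at h3
      rw [← h3] at h2
      apply mul_left_cancel₀ hd0
      linear_combination -e (-(σ : ℂ) * h * j / M) * h2
    · have h1 := sum_range_add_of_periodic (hT j) (-r)
      have h2 : ∀ k : ℤ, S (k + -r) * e ((σ : ℂ) * ((k + -r : ℤ) : ℂ) * (j : ℤ) / M) =
          e ((σ : ℂ) * (κ - r * j) / M) * (S k * e ((σ : ℂ) * k * (j : ℤ) / M)) := by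
        intro k
        rw [← sub_eq_add_neg, hSr]
        have h3 : e ((σ : ℂ) * κ / M) * e ((σ : ℂ) * ((k - r : ℤ) : ℂ) * (j : ℤ) / M) =
            e ((σ : ℂ) * (κ - r * j) / M) * e ((σ : ℂ) * k * (j : ℤ) / M) := by
          rw [← e_add, ← e_add]
          congr 1
          push_cast
          ring
        linear_combination S k * h3
      simp only [h2, ← Finset.mul_sum] at h1
      have h4 : e ((σ : ℂ) * (κ - r * j) / M) ≠ 1 := by
        rw [Ne, e_eq_one_iff]
        rintro ⟨n, hn⟩
        rw [div_eq_iff hM0] at hn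
        have hn' : σ * (κ - r * j) = n * M := by exact_mod_cast hn
        apply hj
        rw [Int.modEq_comm, Int.modEq_iff_dvd]
        rcases hσ with rfl | rfl
        · exact ⟨n, by linarith⟩
        · exact ⟨-n, by linarith⟩
      simp only [Int.cast_natCast] at h1
      have h5 : ∑ k ∈ Finset.range M, S k * e ((σ : ℂ) * k * j / M) = 0 := by
        by_contra h6
        exact h4 (mul_right_cancel₀ h6 (h1.trans (one_mul _).symm))
      rw [h5, mul_zero, mul_zero]
  apply mul_left_cancel₀ hM0
  rw [Finset.mul_sum, Finset.sum_congr rfl fun j _ => hc j]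
  have h1 : ∀ j : ℕ, e (-(σ : ℂ) * h * j / M) * ∑ k ∈ Finset.range M, S k * e ((σ : ℂ) * k * j / M) =
      ∑ k ∈ Finset.range M, S (k + h) * e ((σ : ℂ) * k * j / M) := by
    intro j
    have h2 := sum_range_add_of_periodic (hT j) h
    simp only [Int.cast_natCast] at h2
    rw [← h2, Finset.mul_sum]
    refine Finset.sum_congr rfl fun k _ => ?_
    rw [mul_left_comm, ← e_add]
    congr 2
    push_cast
    ring
  rw [Finset.sum_congr rfl fun j _ => h1 j, Finset.sum_comm]
  simp only [← Finset.mul_sum]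
  rw [Finset.sum_congr rfl fun k hk => by rw [sum_e_eq_ite hM hσ (Finset.mem_range.mp hk)],
    Finset.sum_eq_single 0]
  · simp [mul_comm]
  · intro k _ hk
    rw [if_neg hk, mul_zero]
  · intro h0
    exact absurd (Finset.mem_range.mpr hM) h0

lemma IsFormChar.isoChar_add_of_forall {R : Type*} [CommRing R] [Fintype R] {N r u : R}
    {χ : MulChar R ℂ} {ε : AddChar R ℂ} (H : IsFormChar N r u χ ε) (l : R × R × R × R)
    {w : R × R × R × R} (hw : quadForm N r u w = 0) (hwm : ∀ m, quadPolar N r u w m = 0) :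
    isoChar N r u χ (l + w) = isoChar N r u χ l := by
  have h1 : quadForm N r u (l + w) = quadForm N r u l := by
    rw [quadForm_add, hw, quadPolar_comm, hwm, add_zero, add_zero]
  have h2 : ∀ m, quadPolar N r u (l + w) m = quadPolar N r u l m := fun m => by
    rw [quadPolar_add_left, hwm, add_zero]
  by_cases h : quadForm N r u l = 0 ∧ ∃ m, IsUnit (quadPolar N r u l m)
  · obtain ⟨m, hm, hlm⟩ := H.exists_isotropic h.1 h.2
    exact H.isoChar_eq_of_pairing h.1 (by rw [h1, h.1]) hm hlm (h2 m)
  · rw [isoChar_eq_zero h, isoChar_eq_zero]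
    simpa only [h1, h2] using h

/-- The part of the exponential sum over `κ' + sℓ' + b'ℓ` with `κ' = 2Nt + rk` fixed, as a
function of `k` and `t`. -/
def lineSum {d : ℕ} (F : ZMod d × ZMod d × ZMod d × ZMod d → ℂ) (N : ℕ) (r κ a s k t : ℤ) : ℂ :=
  ∑ b ∈ Finset.range d, F (t, k, b, s) *
    e (-((κ : ℂ) * (2 * N * t + r * k) / (2 * N) + a * b) / d)

/-- The part of the exponential sum over `κ' ∈ rk + 2Nℤ`, as a function of `k`. -/
def cosetSum {d : ℕ} (F : ZMod d × ZMod d × ZMod d × ZMod d → ℂ) (N : ℕ) (r κ a s k : ℤ) : ℂ :=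
  ∑ t ∈ Finset.range d, lineSum F N r κ a s k t

section Shift

variable {d : ℕ} {F : ZMod d × ZMod d × ZMod d × ZMod d → ℂ} {N : ℕ}

lemma lineSum_add (r κ a s k t : ℤ) {w v : ℤ}
    (hF : ∀ l, F (l + ((w : ZMod d), (v : ZMod d), 0, 0)) = F l) :
    lineSum F N r κ a s (k + v) (t + w) =
      e (-((κ : ℂ) * (2 * N * w + r * v) / (2 * N)) / d) * lineSum F N r κ a s k t := by
  rw [lineSum, lineSum, Finset.mul_sum]
  refine Finset.sum_congr rfl fun b _ => ?_
  rw [mul_left_comm, ← e_add, ← hF (t, k, b, s)]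
  congr 2
  · simp
  · push_cast
    ring

lemma lineSum_periodic (hN : 0 < N) [NeZero d] (r κ a s k : ℤ) :
    Function.Periodic (lineSum F N r κ a s k) d := by
  intro t
  have hN0 : (N : ℂ) ≠ 0 := by exact_mod_cast hN.ne'
  have hd0 : (d : ℂ) ≠ 0 := by exact_mod_cast NeZero.ne d
  have h := lineSum_add (F := F) (N := N) r κ a s k t (w := d) (v := 0) fun l => by
    congr 1
    simp
  rw [add_zero] at h
  rw [h]
  have h1 : -((κ : ℂ) * (2 * N * (d : ℤ) + r * (0 : ℤ)) / (2 * N)) / d = (-κ : ℤ) := by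
    push_cast
    field_simp
    ring
  rw [h1, e_intCast, one_mul]

lemma cosetSum_add (hN : 0 < N) [NeZero d] (r κ a s k : ℤ) {w v : ℤ}
    (hF : ∀ l, F (l + ((w : ZMod d), (v : ZMod d), 0, 0)) = F l) :
    cosetSum F N r κ a s (k + v) =
      e (-((κ : ℂ) * (2 * N * w + r * v) / (2 * N)) / d) * cosetSum F N r κ a s k := by
  rw [cosetSum, ← sum_range_add_of_periodic (lineSum_periodic hN r κ a s _) w, cosetSum,
    Finset.mul_sum]
  exact Finset.sum_congr rfl fun t _ => lineSum_add r κ a s k t hF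

end Shift

section GenusChar

variable {N : ℕ} {Δ : ℤ} [NeZero Δ.natAbs] {r u : ℤ} {χ : ℤ → ℤ → ℤ → ℤ}

lemma isoChar_fundChar_add (hN : 0 < N) (hΔ : IsFundamentalDiscriminant Δ)
    (hr : r ^ 2 - 4 * (N : ℤ) * u = Δ) {w v : ℤ} (h1 : Δ ∣ 2 * N * w + r * v)
    (h2 : Δ ∣ r * w + 2 * u * v) (h3 : Δ ∣ N * w ^ 2 + r * w * v + u * v ^ 2)
    (l : ZMod Δ.natAbs × ZMod Δ.natAbs × ZMod Δ.natAbs × ZMod Δ.natAbs) :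
    isoChar ((N : ℤ) : ZMod Δ.natAbs) r u (fundChar hΔ)
        (l + ((w : ZMod Δ.natAbs), (v : ZMod Δ.natAbs), 0, 0)) =
      isoChar ((N : ℤ) : ZMod Δ.natAbs) r u (fundChar hΔ) l := by
  have hz : ∀ x : ℤ, Δ ∣ x → (x : ZMod Δ.natAbs) = 0 := fun x hx => by
    rwa [ZMod.intCast_zmod_eq_zero_iff_dvd, Int.natAbs_dvd]
  have h1 := hz _ h1
  have h2 := hz _ h2
  have h3 := hz _ h3
  push_cast at h1 h2 h3
  refine (isFormChar_fundChar hΔ (by exact_mod_cast hN) hr).isoChar_add_of_forall l ?_ ?_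
  · simp only [quadForm, binForm]
    push_cast
    linear_combination h3
  · intro m
    simp only [quadPolar, binPolar]
    push_cast
    linear_combination m.1 * h1 + m.2.1 * h2

lemma sum_ite_eq_cosetSum (hN : 0 < N) (hΔ : IsFundamentalDiscriminant Δ)
    (hr : r ^ 2 - 4 * (N : ℤ) * u = Δ) (hχ : IsGenusChar N Δ χ) (h κ a s : ℤ) :
    (∑ x ∈ Finset.range (2 * N * Δ.natAbs), ∑ b' ∈ Finset.range Δ.natAbs,
      if (x : ℤ) ≡ r * h [ZMOD (2 * (N : ℤ))] ∧
          (x : ℤ) ^ 2 + 4 * (N : ℤ) * (b' : ℤ) * s ≡ Δ * h ^ 2 [ZMOD (4 * (N : ℤ) * Δ)] then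
        (χ (-(b' : ℤ)) (x : ℤ) s : ℂ) *
          e (-((κ : ℂ) * (x : ℂ) / (2 * (N : ℂ)) + (a : ℂ) * (b' : ℂ)) / (Δ.natAbs : ℂ))
      else 0) =
    cosetSum (isoChar ((N : ℤ) : ZMod Δ.natAbs) r u (fundChar hΔ)) N r κ a s h := by
  have hN0 : (N : ℂ) ≠ 0 := by exact_mod_cast hN.ne'
  have hd0 : (Δ.natAbs : ℂ) ≠ 0 := by exact_mod_cast NeZero.ne Δ.natAbs
  let f : ℤ → ℂ := fun x => ∑ b ∈ Finset.range Δ.natAbs,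
    (if x ^ 2 + 4 * (N : ℤ) * (b : ℤ) * s ≡ Δ * h ^ 2 [ZMOD (4 * (N : ℤ) * Δ)] then
      (χ (-(b : ℤ)) x s : ℂ) else 0) *
        e (-((κ : ℂ) * x / (2 * N) + a * b) / Δ.natAbs)
  have hΔd : Δ ∣ (Δ.natAbs : ℤ) := Int.dvd_natAbs_self
  have hf : Function.Periodic f (((2 * N : ℕ) : ℤ) * Δ.natAbs) := by
    intro x
    refine Finset.sum_congr rfl fun b _ => ?_
    obtain ⟨c, hc⟩ := hΔd
    have h1 : (x + ((2 * N : ℕ) : ℤ) * Δ.natAbs) ^ 2 + 4 * (N : ℤ) * b * s ≡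
        x ^ 2 + 4 * (N : ℤ) * b * s [ZMOD (4 * (N : ℤ) * Δ)] := by
      rw [Int.modEq_comm, Int.modEq_iff_dvd]
      refine ⟨c * (x + N * Δ.natAbs), ?_⟩
      rw [hc, Nat.cast_mul, Nat.cast_ofNat]
      ring
    have h2 : χ (-(b : ℤ)) (x + ((2 * N : ℕ) : ℤ) * Δ.natAbs) s = χ (-(b : ℤ)) x s := by
      refine hχ.1 _ _ _ _ _ _ rfl ?_ rfl
      rw [Int.modEq_comm, Int.modEq_iff_dvd]
      refine ⟨c, ?_⟩
      rw [hc, Nat.cast_mul, Nat.cast_ofNat]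
      ring
    have h3 : e (-((κ : ℂ) * ((x + ((2 * N : ℕ) : ℤ) * Δ.natAbs : ℤ) : ℂ) / (2 * N) + a * b) /
        Δ.natAbs) = e (-((κ : ℂ) * x / (2 * N) + a * b) / Δ.natAbs) := by
      apply e_eq_of_sub_eq_intCast (-κ)
      simp only [Int.cast_add, Int.cast_mul, Int.cast_natCast, Nat.cast_mul, Nat.cast_ofNat,
        Int.cast_neg]
      field_simp
      ring
    rw [h2, h3]
    congr 1
    exact if_congr ⟨h1.symm.trans, h1.trans⟩ rfl rfl
  have h1 := sum_range_mul_ite_modEq (by positivity : 0 < 2 * N) Δ.natAbs hf (r * h)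
  rw [cosetSum]
  refine Eq.trans (Finset.sum_congr rfl fun x _ => ?_)
    (h1.trans (Finset.sum_congr rfl fun t _ => ?_))
  · by_cases hx : (x : ℤ) ≡ r * h [ZMOD (2 * (N : ℤ))]
    · rw [if_pos (by exact_mod_cast hx)]
      refine Finset.sum_congr rfl fun b _ => ?_
      simp [hx]
    · rw [if_neg (by exact_mod_cast hx)]
      simp [hx]
  · refine Finset.sum_congr rfl fun b _ => ?_
    rw [genusChar_eq_isoChar hN hΔ hr hχ (t := t) (x := ((2 * N : ℕ) : ℤ) * t + r * h)
      (by push_cast; rfl)]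
    push_cast
    rfl

lemma natAbs_mul_sum_eq_sum_cosetSum (hN : 0 < N) (hΔ : IsFundamentalDiscriminant Δ)
    (hr : r ^ 2 - 4 * (N : ℤ) * u = Δ) (hχ : IsGenusChar N Δ χ) {κ j : ℤ} (a s : ℤ)
    (hκ : κ ≡ r * j [ZMOD ((2 * N : ℕ) : ℤ)]) :
    (Δ.natAbs : ℂ) * (fundGauss hΔ * ∑ b ∈ Finset.range Δ.natAbs,
      if κ ^ 2 + 4 * (N : ℤ) * (b : ℤ) * a ≡ Δ * j ^ 2 [ZMOD (4 * (N : ℤ) * Δ)] then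
        (χ (-(b : ℤ)) κ a : ℂ) * e ((b : ℂ) * (s : ℂ) / (Δ.natAbs : ℂ)) else 0) =
    ∑ k ∈ Finset.range Δ.natAbs,
      cosetSum (isoChar ((N : ℤ) : ZMod Δ.natAbs) r u (fundChar hΔ)) N r κ a s k *
        e ((Δ.sign : ℂ) * k * j / (2 * N : ℕ)) := by
  have hN0 : (N : ℂ) ≠ 0 := by exact_mod_cast hN.ne'
  have hd0 : (Δ.natAbs : ℂ) ≠ 0 := by exact_mod_cast NeZero.ne Δ.natAbs
  have hΔσ : (Δ.sign : ℂ) * Δ.natAbs = Δ := by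
    conv_rhs => rw [← Int.sign_mul_natAbs Δ]
    rw [Int.cast_mul, Int.cast_natCast]
  have hr' : (r : ℂ) ^ 2 - 4 * N * u = Δ := by exact_mod_cast hr
  obtain ⟨t', ht'⟩ : ∃ t' : ℤ, κ = 2 * N * t' + r * j := by
    obtain ⟨c, hc⟩ := (Int.modEq_iff_dvd.mp hκ.symm)
    push_cast at hc
    exact ⟨c, by linarith⟩
  have hκ' : (κ : ℂ) = 2 * N * t' + r * j := by exact_mod_cast ht'
  have h1 := (isFormChar_fundChar hΔ (by exact_mod_cast hN) hr).partial_fourier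
    (t' : ZMod Δ.natAbs) j a s
  simp only [ZMod.sum_eq_sum_range, ZMod.card] at h1
  have h2 : ∀ b ∈ Finset.range Δ.natAbs,
      (if κ ^ 2 + 4 * (N : ℤ) * (b : ℤ) * a ≡ Δ * j ^ 2 [ZMOD (4 * (N : ℤ) * Δ)] then
        (χ (-(b : ℤ)) κ a : ℂ) * e ((b : ℂ) * (s : ℂ) / (Δ.natAbs : ℂ)) else 0) =
      isoChar ((N : ℤ) : ZMod Δ.natAbs) r u (fundChar hΔ) (t', j, b, a) *
        ZMod.stdAddChar ((b : ZMod Δ.natAbs) * (s : ZMod Δ.natAbs)) := by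
    intro b _
    have h3 := genusChar_eq_isoChar hN hΔ hr hχ (b := b) (s := a) ht'
    have h4 := stdAddChar_intCast_eq_e (d := Δ.natAbs) ((b : ℤ) * s)
    push_cast at h3 h4
    push_cast
    rw [← h3, h4, ite_mul, zero_mul]
  rw [Finset.sum_congr rfl h2, ← mul_assoc, mul_comm (Δ.natAbs : ℂ)]
  refine h1.symm.trans ?_
  rw [Finset.sum_comm]
  refine Finset.sum_congr rfl fun k _ => ?_
  rw [cosetSum, Finset.sum_mul]
  refine Finset.sum_congr rfl fun t _ => ?_
  rw [lineSum, Finset.sum_mul]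
  refine Finset.sum_congr rfl fun b _ => ?_
  have h5 := stdAddChar_intCast_eq_e (d := Δ.natAbs)
    (-(binPolar (N : ℤ) r u t k t' j + b * a))
  simp only [binPolar] at h5 ⊢
  push_cast at h5 ⊢
  rw [h5, mul_assoc (isoChar _ _ _ _ _), ← e_add]
  congr 2
  rw [hκ']
  field_simp
  linear_combination (k : ℂ) * j * hr' - (k : ℂ) * j * hΔσ

end GenusChar

/-- Bruinier–Ono, Proposition 4.6: Let `Δ` be a fundamental discriminant
and `r ∈ ℤ` with `Δ ≡ r² (mod 4N)`.  For `h ∈ K'/K ≅ ℤ/2Nℤ`, `κ ∈ K'/ΔK ≅ ℤ/2NΔℤ`,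
`a ∈ ℤ/Δℤ` and `s ∈ ℤ/Δℤ` (given by integer representatives `h, κ, a, s`), the
exponential sum `g_h(κ, a, s)` equals
`ε |Δ|^{1/2} ∑_{h' ∈ K'/K, κ ≡ rh' (K)} e(-sgn(Δ)(h,h'))
  ∑_{b (Δ), Q(κ + aℓ' + bℓ) ≡ ΔQ(h') (Δ)} χ_Δ(κ + aℓ' + bℓ) e(bs/|Δ|)`,
where `ε = 1` if `Δ > 0` and `ε = i` if `Δ < 0`.  In coordinates `κ' + sℓ' + b'ℓ`
corresponds to the form `[-b', κ', Ns]` (coordinates `(-b', κ', s)`), so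
`Q(κ' + sℓ' + b'ℓ) = (κ'² + 4Nb's)/4N`, and `(κ, κ') = κκ'/2N`. -/
theorem twisted_gauss_sum_K
    (N : ℕ) (hN : 0 < N) (Δ : ℤ) (hΔ : IsFundamentalDiscriminant Δ)
    (r : ℤ) (hr : Δ ≡ r ^ 2 [ZMOD (4 * (N : ℤ))])
    (χ : ℤ → ℤ → ℤ → ℤ) (hχ : IsGenusChar N Δ χ)
    (h κ a s : ℤ) :
    (∑ x ∈ Finset.range (2 * N * Δ.natAbs), ∑ b' ∈ Finset.range Δ.natAbs,
      if (x : ℤ) ≡ r * h [ZMOD (2 * (N : ℤ))] ∧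
          (x : ℤ) ^ 2 + 4 * (N : ℤ) * (b' : ℤ) * s ≡ Δ * h ^ 2 [ZMOD (4 * (N : ℤ) * Δ)] then
        (χ (-(b' : ℤ)) (x : ℤ) s : ℂ) *
          e (-((κ : ℂ) * (x : ℂ) / (2 * (N : ℂ)) + (a : ℂ) * (b' : ℂ)) / (Δ.natAbs : ℂ))
      else 0) =
    (if 0 < Δ then 1 else Complex.I) * (Real.sqrt Δ.natAbs : ℂ) *
      ∑ h' ∈ Finset.range (2 * N),
        if κ ≡ r * (h' : ℤ) [ZMOD (2 * (N : ℤ))] then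
          e (-(Δ.sign : ℂ) * (h : ℂ) * (h' : ℂ) / (2 * (N : ℂ))) *
            ∑ b'' ∈ Finset.range Δ.natAbs,
              if κ ^ 2 + 4 * (N : ℤ) * (b'' : ℤ) * a ≡ Δ * (h' : ℤ) ^ 2
                  [ZMOD (4 * (N : ℤ) * Δ)] then
                (χ (-(b'' : ℤ)) κ a : ℂ) * e ((b'' : ℂ) * (s : ℂ) / (Δ.natAbs : ℂ))
              else 0
        else 0 := by
  obtain ⟨u, hu⟩ : ∃ u, r ^ 2 - 4 * (N : ℤ) * u = Δ := by
    obtain ⟨u, hu⟩ := Int.modEq_iff_dvd.mp hr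
    exact ⟨u, by linarith⟩
  have hΔ0 := hΔ.ne_zero
  have : NeZero Δ.natAbs := ⟨Int.natAbs_ne_zero.mpr hΔ0⟩
  have hN0 : (N : ℂ) ≠ 0 := by exact_mod_cast hN.ne'
  have hd0 : (Δ.natAbs : ℂ) ≠ 0 := by exact_mod_cast NeZero.ne Δ.natAbs
  have hΔσ : (Δ.sign : ℂ) * Δ.natAbs = Δ := by
    conv_rhs => rw [← Int.sign_mul_natAbs Δ]
    rw [Int.cast_mul, Int.cast_natCast]
  have hu' : (r : ℂ) ^ 2 - 4 * N * u = Δ := by exact_mod_cast hu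
  have hσ : Δ.sign = 1 ∨ Δ.sign = -1 := by
    rcases lt_or_gt_of_ne hΔ0 with h0 | h0
    · exact Or.inr (Int.sign_eq_neg_one_of_neg h0)
    · exact Or.inl (Int.sign_eq_one_of_pos h0)
  have hd : Δ ∣ (Δ.natAbs : ℤ) := Int.dvd_natAbs_self
  have key := sum_ite_modEq_eq_of_quasiperiodic (by positivity : 0 < 2 * N)
    (Nat.pos_of_neZero Δ.natAbs) hσ κ r
    (S := cosetSum (isoChar ((N : ℤ) : ZMod Δ.natAbs) r u (fundChar hΔ)) N r κ a s)
    (A := fun j => fundGauss hΔ * ∑ b ∈ Finset.range Δ.natAbs,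
      if κ ^ 2 + 4 * (N : ℤ) * (b : ℤ) * a ≡ Δ * j ^ 2 [ZMOD (4 * (N : ℤ) * Δ)] then
        (χ (-(b : ℤ)) κ a : ℂ) * e ((b : ℂ) * (s : ℂ) / (Δ.natAbs : ℂ)) else 0)
    ?_ ?_ ?_ (fun j hj => natAbs_mul_sum_eq_sum_cosetSum hN hΔ hu hχ a s hj) h
  · rw [sum_ite_eq_cosetSum hN hΔ hu hχ, ← key, ← fundGauss_eq hΔ, Finset.mul_sum]
    refine Finset.sum_congr rfl fun j _ => ?_
    push_cast
    rw [mul_ite, mul_zero, mul_left_comm]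
  · intro k
    rw [cosetSum_add hN r κ a s k (w := -r) (v := (2 * N : ℕ))
      (isoChar_fundChar_add hN hΔ hu ⟨0, ?_⟩ ⟨-1, ?_⟩ ⟨-N, ?_⟩)]
    · have h1 : -((κ : ℂ) * (2 * N * (-r : ℤ) + r * ((2 * N : ℕ) : ℤ)) / (2 * N)) / Δ.natAbs =
          (0 : ℤ) := by
        push_cast
        ring
      rw [h1, e_intCast, one_mul]
    all_goals
      rw [← hu]
      push_cast
      ring
  · intro k
    rw [sub_eq_add_neg, cosetSum_add hN r κ a s k (w := 2 * u) (v := -r)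
      (isoChar_fundChar_add hN hΔ hu ⟨-1, ?_⟩ ⟨0, ?_⟩ ⟨-u, ?_⟩)]
    · congr 2
      push_cast
      field_simp
      linear_combination (κ : ℂ) * (hu' - hΔσ)
    all_goals
      rw [← hu]
      ring
  · intro j hj k
    obtain ⟨c, hc⟩ := Int.modEq_iff_dvd.mp hj.symm
    have hc' : (κ : ℂ) - r * j = 2 * N * c := by exact_mod_cast hc
    change cosetSum _ N r κ a s (k + (Δ.natAbs : ℤ)) *
      e ((Δ.sign : ℂ) * ((k + (Δ.natAbs : ℤ) : ℤ) : ℂ) * j / (2 * N : ℕ)) = _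
    rw [cosetSum_add hN r κ a s k (w := 0) (v := Δ.natAbs)
      (isoChar_fundChar_add hN hΔ hu ?_ ?_ ?_), mul_right_comm, ← e_add, mul_comm]
    · congr 1
      apply e_eq_of_sub_eq_intCast (-2 * u * j - c * r)
      simp only [Int.cast_add, Int.cast_mul, Int.cast_natCast, Nat.cast_mul, Nat.cast_ofNat,
        Int.cast_neg, Int.cast_sub, Int.cast_zero, Int.cast_ofNat]
      field_simp
      linear_combination (Δ.natAbs : ℂ) * (j * hΔσ - j * hu' - r * hc')
    · simpa using hd.mul_left r
    · simpa using hd.mul_left (2 * u)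
    · obtain ⟨m, hm⟩ := hd
      exact ⟨u * Δ * m ^ 2, by rw [hm]; ring⟩
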